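/- Let n ≥ 1, p ∈ [1/2,∞], p₁,p₂ ∈ [1,∞], and a,a₁,a₂ ≥ 0 satisfy 1/p = 1/p₁ + 1/p₂ and a/p = a₁/p₁ + a₂/p₂. Suppose s > max{0, n(1/p − 1)} or s ∈ 2ℕ. Then there exists a constant C > 0, depending only on n, s, p, p₁, p₂, a₁, a₂, such that for all f, g ∈ 𝒮(ℝⁿ): ‖J^s(fg)‖_{L^p_{⟨x⟩^a}} ≤ C ( ‖J^s f‖_{L^{p₁}_{⟨x⟩^{a₁}}} ‖g‖_{L^{p₂}_{⟨x⟩^{a₂}}} + ‖f‖_{L^{p₁}_{⟨x⟩^{a₁}}} ‖J^s g‖_{L^{p₂}_{⟨x⟩^{a₂}}} ). -/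

import Mathlib

open MeasureTheory Real Complex
open scoped ENNReal NNReal RealInnerProductSpace

noncomputable section

abbrev Eu (n : ℕ) := EuclideanSpace ℝ (Fin n)

/-- The polynomial weight `⟨x⟩^a = (1+|x|²)^{a/2}` as an `ℝ≥0∞`-valued function. -/
def jweight {n : ℕ} (a : ℝ) (x : Eu n) : ℝ≥0∞ :=
  ENNReal.ofReal ((1 + ‖x‖ ^ 2) ^ (a / 2))

/-- Weighted Lebesgue (quasi-)norm `‖f‖_{L^p_{⟨x⟩^a}}`; for `p = ∞` the essential sup norm. -/
def wNorm {n : ℕ} {F : Type*} [NormedAddCommGroup F] (p : ℝ≥0∞) (a : ℝ)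
    (f : Eu n → F) : ℝ≥0∞ :=
  if p = ∞ then essSup (fun x => (‖f x‖₊ : ℝ≥0∞)) volume
  else (∫⁻ x, (‖f x‖₊ : ℝ≥0∞) ^ p.toReal * jweight a x) ^ (1 / p.toReal)

/-- The Fourier transform `f̂(ξ) = ∫ f(x) e^{-i x·ξ} dx`. -/
def FT {n : ℕ} (f : Eu n → ℂ) (ξ : Eu n) : ℂ :=
  ∫ x, f x * Complex.exp (-(Complex.I * ((⟪x, ξ⟫ : ℝ) : ℂ)))

/-- The inhomogeneous fractional derivative (Bessel potential) `J^s`. -/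
def Js {n : ℕ} (s : ℝ) (f : Eu n → ℂ) (x : Eu n) : ℂ :=
  ((((2 * Real.pi) ^ n)⁻¹ : ℝ) : ℂ) *
    ∫ ξ, (((1 + ‖ξ‖ ^ 2) ^ (s / 2) : ℝ) : ℂ) * FT f ξ *
      Complex.exp (Complex.I * ((⟪x, ξ⟫ : ℝ) : ℂ))

section

/-! ### Sum lemmas -/

lemma kp_geo_min_aux (r : ℝ) (hr : 1 < r) (w : ℝ) (hw : 0 < w) (N : ℕ) :
    ∑ j ∈ Finset.range N, min (w * r ^ j) ((w * r ^ j)⁻¹) ≤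
      (2 * (1 + r) / (r - 1)) * ((w * r ^ N) / (1 + w * r ^ N) - w / (1 + w)) := by
  induction N with
  | zero => simp
  | succ N ih =>
    rw [Finset.sum_range_succ]
    have hx : 0 < w * r ^ N := by positivity
    set x := w * r ^ N with hxd
    have e : w * r ^ (N + 1) = x * r := by rw [hxd]; ring
    rw [e]
    have key : min x x⁻¹ ≤ (2 * (1 + r) / (r - 1)) * ((x * r) / (1 + x * r) - x / (1 + x)) := by
      have h1 : (x * r) / (1 + x * r) - x / (1 + x) = x * (r - 1) / ((1 + x * r) * (1 + x)) := by
        field_simp; ring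
      have hr1 : 0 < r - 1 := by linarith
      have h2 : (2 * (1 + r) / (r - 1)) * (x * (r - 1) / ((1 + x * r) * (1 + x)))
          = 2 * (1 + r) * x / ((1 + x * r) * (1 + x)) := by field_simp
      rw [h1, h2, le_div_iff₀ (by positivity)]
      rcases le_total x 1 with h | h
      · refine le_trans (mul_le_mul_of_nonneg_right (min_le_left _ _) (by positivity)) ?_
        have : (1 + x * r) * (1 + x) ≤ (1 + r) * 2 := by
          apply mul_le_mul <;> nlinarith
        nlinarith
      · refine le_trans (mul_le_mul_of_nonneg_right (min_le_right _ _) (by positivity)) ?_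
        rw [inv_mul_le_iff₀ hx]
        have : (1 + x * r) * (1 + x) ≤ ((1 + r) * x) * (2 * x) := by
          apply mul_le_mul <;> nlinarith
        nlinarith
    linarith

lemma kp_geo_min (r : ℝ) (hr : 1 < r) (a b : ℝ) (ha : 0 ≤ a) (hb : 0 ≤ b) (N : ℕ) :
    ∑ j ∈ Finset.range N, min (a ^ 2 * r ^ j) (b ^ 2 * (r ^ j)⁻¹) ≤
      (2 * (1 + r) / (r - 1)) * (a * b) := by
  have hr1 : 0 < r - 1 := by linarith
  rcases ha.eq_or_lt with h | ha
  · subst h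
    simp
    apply Finset.sum_nonpos
    intros; simp
  rcases hb.eq_or_lt with h | hb
  · subst h
    simp
    apply Finset.sum_nonpos
    intros; simp
  have h := kp_geo_min_aux r hr (a / b) (by positivity) N
  have e : ∀ j ∈ Finset.range N, min (a ^ 2 * r ^ j) (b ^ 2 * (r ^ j)⁻¹) =
      (a * b) * min (a / b * r ^ j) ((a / b * r ^ j)⁻¹) := by
    intro j _
    rw [mul_min_of_nonneg _ _ (by positivity : 0 ≤ a * b)]
    congr 1 <;> field_simp
  rw [Finset.sum_congr rfl e, ← Finset.mul_sum, mul_comm]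
  apply mul_le_mul_of_nonneg_right _ (by positivity)
  refine h.trans ?_
  have h1 : (a / b * r ^ N) / (1 + a / b * r ^ N) ≤ 1 := by
    rw [div_le_one (by positivity)]; linarith
  have h2 : 0 ≤ a / b / (1 + a / b) := by positivity
  have h3 : 0 ≤ 2 * (1 + r) / (r - 1) := by positivity
  nlinarith

lemma kp_eps (ρ τ : ℝ) (hρ : 1 < ρ) (hτ1 : τ < 1) :
    ∃ ε : ℝ, 0 < ε ∧ ε < 1 ∧ τ * ρ ^ (ε / 2) < 1 := by
  have hc : ContinuousAt (fun ε : ℝ => τ * ρ ^ (ε / 2)) 0 := by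
    apply ContinuousAt.mul continuousAt_const
    exact ContinuousAt.rpow continuousAt_const (by fun_prop) (Or.inl (by positivity))
  have h0 : τ * ρ ^ ((0:ℝ) / 2) < 1 := by simpa
  have := hc.eventually (gt_mem_nhds h0)
  obtain ⟨δ, hδ, h⟩ := Metric.eventually_nhds_iff.1 this
  refine ⟨min (δ / 2) (1 / 2), by positivity, ?_, ?_⟩
  · exact (min_le_right _ _).trans_lt (by norm_num)
  · apply h
    rw [Real.dist_eq, sub_zero, abs_of_pos (by positivity)]
    exact (min_le_left _ _).trans_lt (by linarith)

lemma kp_sum_real (ρ τ : ℝ) (hρ : 1 < ρ) (hτ : 0 < τ) (hτ1 : τ < 1) :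
    ∃ C : ℝ, 0 < C ∧ ∀ A A' B B' : ℝ, 0 ≤ A → 0 ≤ A' → 0 ≤ B → 0 ≤ B' → ∀ N : ℕ,
      ∑ j ∈ Finset.range N, ∑ k ∈ Finset.range (j + 1),
        ρ ^ j * τ ^ (j - k) * (min A ((ρ ^ k)⁻¹ * A') * min B ((ρ ^ j)⁻¹ * B')) ≤
      C * (A' * B + A * B') := by
  obtain ⟨ε, hε, hε1, hlt⟩ := kp_eps ρ τ hρ hτ1
  have hρ0 : 0 < ρ := by linarith
  set r := ρ ^ ε with hr
  have hr1 : 1 < r := Real.one_lt_rpow hρ hε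
  set K := 2 * (1 + r) / (r - 1) with hK
  have hr1' : 0 < r - 1 := by linarith
  have hK0 : 0 < K := by positivity
  set θ := τ * ρ ^ (ε / 2) with hθ
  have hθ0 : 0 < θ := by positivity
  have h1θ : 0 < 1 - θ := by linarith
  refine ⟨K / (1 - θ), by positivity, ?_⟩
  intro A A' B B' hA hA' hB hB' N
  set t : ℕ → ℕ → ℝ := fun d j => min (A * B * ρ ^ j) (min (A * B') (ρ ^ d * (ρ ^ j)⁻¹ * (A' * B')))
    with ht
  have ht0 : ∀ d j, 0 ≤ t d j := by
    intro d j; simp only [ht]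
    refine le_min (by positivity) (le_min (by positivity) (by positivity))
  have step1 : ∀ j ∈ Finset.range N, ∑ k ∈ Finset.range (j + 1),
        ρ ^ j * τ ^ (j - k) * (min A ((ρ ^ k)⁻¹ * A') * min B ((ρ ^ j)⁻¹ * B')) ≤
        ∑ d ∈ Finset.range N, τ ^ d * t d j := by
    intro j hj
    rw [Finset.mem_range] at hj
    calc _ ≤ ∑ k ∈ Finset.range (j + 1), τ ^ (j - k) * t (j - k) j := by
          apply Finset.sum_le_sum
          intro k hk
          rw [Finset.mem_range] at hk
          have hρj : 0 < ρ ^ j := by positivity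
          have hpow : ρ ^ j = ρ ^ (j - k) * ρ ^ k := by rw [← pow_add]; congr 1; omega
          rw [mul_comm (ρ ^ j), mul_assoc]
          apply mul_le_mul_of_nonneg_left _ (by positivity)
          have m1 : 0 ≤ min A ((ρ ^ k)⁻¹ * A') := le_min hA (by positivity)
          have m2 : 0 ≤ min B ((ρ ^ j)⁻¹ * B') := le_min hB (by positivity)
          refine le_min ?_ (le_min ?_ ?_)
          · calc _ ≤ ρ ^ j * (A * B) := by
                  gcongr
                  · exact min_le_left _ _
                  · exact min_le_left _ _
              _ = _ := by ring
          · calc _ ≤ ρ ^ j * (A * ((ρ ^ j)⁻¹ * B')) := by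
                  gcongr
                  · exact min_le_left _ _
                  · exact min_le_right _ _
              _ = _ := by field_simp
          · calc _ ≤ ρ ^ j * (((ρ ^ k)⁻¹ * A') * ((ρ ^ j)⁻¹ * B')) := by
                  gcongr
                  · exact min_le_right _ _
                  · exact min_le_right _ _
              _ = ρ ^ (j-k) * (ρ ^ j)⁻¹ * (A' * B') := by rw [hpow]; field_simp
      _ = ∑ d ∈ Finset.range (j + 1), τ ^ d * t d j := by
          have := Finset.sum_range_reflect (fun d => τ ^ d * t d j) (j + 1)
          rw [← this]
          apply Finset.sum_congr rfl
          intro k hk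
          simp
      _ ≤ _ := by
          apply Finset.sum_le_sum_of_subset_of_nonneg
          · intro d hd; simp at hd ⊢; omega
          · intros; have := ht0; positivity
  refine (Finset.sum_le_sum step1).trans ?_
  rw [Finset.sum_comm]
  set X := A' * B with hX
  set Y := A * B' with hY
  have hX0 : 0 ≤ X := by positivity
  have hY0 : 0 ≤ Y := by positivity
  have step2 : ∀ d ∈ Finset.range N, ∑ j ∈ Finset.range N, τ ^ d * t d j ≤ θ ^ d * (K * (X + Y)) := by
    intro d _
    rw [← Finset.mul_sum]
    have hmean : Y ^ (1 - ε) * (X * Y) ^ (ε / 2) ≤ X + Y := by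
      have : Y ^ (1 - ε) * (X * Y) ^ (ε / 2) = X ^ (ε / 2) * Y ^ (1 - ε / 2) := by
        rw [Real.mul_rpow hX0 hY0, mul_left_comm, ← Real.rpow_add_of_nonneg hY0 (by linarith) (by linarith)]
        congr 2; ring
      rw [this]
      have := Real.geom_mean_le_arith_mean2_weighted (w₁ := ε / 2) (w₂ := 1 - ε / 2) (by linarith) (by linarith) hX0 hY0 (by ring)
      nlinarith
    have h1 : ∀ j ∈ Finset.range N, t d j ≤
        Y ^ (1 - ε) * min (((A * B) ^ (ε / 2)) ^ 2 * r ^ j)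
          (((ρ ^ d * (A' * B')) ^ (ε / 2)) ^ 2 * (r ^ j)⁻¹) := by
      intro j _
      have hsq : ∀ z : ℝ, 0 ≤ z → (z ^ (ε / 2)) ^ 2 = z ^ ε := by
        intro z hz
        rw [← Real.rpow_natCast, ← Real.rpow_mul hz]; congr 1; push_cast; ring
      rw [hsq _ (by positivity), hsq _ (by positivity)]
      have hrj : r ^ j = (ρ ^ j) ^ ε := by
        rw [hr, ← Real.rpow_natCast, ← Real.rpow_natCast, ← Real.rpow_mul hρ0.le, ← Real.rpow_mul hρ0.le, mul_comm]
      rw [hrj, ← Real.inv_rpow (by positivity), ← Real.mul_rpow (by positivity) (by positivity),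
        ← Real.mul_rpow (by positivity) (by positivity)]
      have hsplit : t d j = (t d j) ^ (1 - ε) * (t d j) ^ ε := by
        rw [← Real.rpow_add_of_nonneg (ht0 d j) (by linarith) (by linarith)]; simp
      rw [hsplit]
      have := ht0 d j
      apply mul_le_mul _ _ (by positivity) (by positivity)
      · apply Real.rpow_le_rpow this _ (by linarith)
        exact (min_le_right _ _).trans (min_le_left _ _)
      · refine le_min ?_ ?_
        · apply Real.rpow_le_rpow this _ (by linarith)
          exact (min_le_left _ _)
        · apply Real.rpow_le_rpow this _ (by linarith)
          refine (min_le_right _ _).trans ((min_le_right _ _).trans ?_)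
          apply le_of_eq; ring
    have h2 : ∑ j ∈ Finset.range N, t d j ≤ (ρ ^ (ε / 2)) ^ d * (K * (X + Y)) := by
      refine (Finset.sum_le_sum h1).trans ?_
      rw [← Finset.mul_sum]
      calc _ ≤ Y ^ (1 - ε) * (K * ((A * B) ^ (ε / 2) * (ρ ^ d * (A' * B')) ^ (ε / 2))) := by
            gcongr
            exact kp_geo_min r hr1 _ _ (by positivity) (by positivity) N
        _ = (ρ ^ (ε / 2)) ^ d * (K * (Y ^ (1 - ε) * (X * Y) ^ (ε / 2))) := by
            have : (ρ ^ (ε / 2)) ^ d = (ρ ^ d) ^ (ε / 2) := by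
              rw [← Real.rpow_natCast, ← Real.rpow_natCast, ← Real.rpow_mul hρ0.le, ← Real.rpow_mul hρ0.le, mul_comm]
            rw [this, Real.mul_rpow (x := ρ ^ d) (by positivity) (by positivity), Real.mul_rpow (x := X) hX0 hY0, hX, hY,
              Real.mul_rpow hA hB, Real.mul_rpow hA' hB', Real.mul_rpow hA hB', Real.mul_rpow hA' hB]
            simp only [Real.mul_rpow hA hB']
            ring
        _ ≤ _ := by gcongr
    calc _ ≤ τ ^ d * ((ρ ^ (ε / 2)) ^ d * (K * (X + Y))) := by gcongr
      _ = _ := by rw [hθ, mul_pow]; ring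
  refine (Finset.sum_le_sum step2).trans ?_
  rw [← Finset.sum_mul]
  have hgeo : ∑ d ∈ Finset.range N, θ ^ d ≤ 1 / (1 - θ) := by
    rw [geom_sum_eq (by linarith), ← neg_div_neg_eq, neg_sub, neg_sub]
    gcongr
    have : 0 < θ ^ N := by positivity
    linarith
  calc _ ≤ 1 / (1 - θ) * (K * (X + Y)) := by gcongr
    _ = _ := by ring

lemma kp_sum_enn (ρ τ : ℝ) (hρ : 1 < ρ) (hτ : 0 < τ) (hτ1 : τ < 1) :
    ∃ C : ℝ, 0 < C ∧ ∀ A A' B B' : ℝ≥0∞, ∀ N : ℕ,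
      ∑ j ∈ Finset.range N, ∑ k ∈ Finset.range (j + 1),
        ENNReal.ofReal (ρ ^ j * τ ^ (j - k)) *
          (min A (ENNReal.ofReal (ρ ^ k)⁻¹ * A') * min B (ENNReal.ofReal (ρ ^ j)⁻¹ * B')) ≤
      ENNReal.ofReal C * (A' * B + A * B') := by
  obtain ⟨C, hC, h⟩ := kp_sum_real ρ τ hρ hτ hτ1
  refine ⟨C, hC, ?_⟩
  intro A A' B B' N
  have hρ0 : 0 < ρ := by linarith
  have hCne : ENNReal.ofReal C ≠ 0 := by simpa using hC
  have hzero : (A = 0 ∨ A' = 0 ∨ B = 0 ∨ B' = 0) → ∑ j ∈ Finset.range N, ∑ k ∈ Finset.range (j + 1),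
        ENNReal.ofReal (ρ ^ j * τ ^ (j - k)) *
          (min A (ENNReal.ofReal (ρ ^ k)⁻¹ * A') * min B (ENNReal.ofReal (ρ ^ j)⁻¹ * B')) ≤
      ENNReal.ofReal C * (A' * B + A * B') := by
    rintro (h | h | h | h) <;> subst h <;> simp
  by_cases hz : (A = 0 ∨ A' = 0 ∨ B = 0 ∨ B' = 0)
  · exact hzero hz
  push Not at hz
  obtain ⟨z1, z2, z3, z4⟩ := hz
  by_cases ht : (A = ⊤ ∨ A' = ⊤ ∨ B = ⊤ ∨ B' = ⊤)
  · have : ENNReal.ofReal C * (A' * B + A * B') = ⊤ := by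
      rcases ht with h | h | h | h <;> subst h <;> simp [ENNReal.top_mul, ENNReal.mul_top, *]
    rw [this]; exact le_top
  push Not at ht
  obtain ⟨t1, t2, t3, t4⟩ := ht
  lift A to ℝ≥0 using t1
  lift A' to ℝ≥0 using t2
  lift B to ℝ≥0 using t3
  lift B' to ℝ≥0 using t4
  have := ENNReal.ofReal_le_ofReal (h A A' B B' A.2 A'.2 B.2 B'.2 N)
  convert this using 1
  · rw [ENNReal.ofReal_sum_of_nonneg]
    · apply Finset.sum_congr rfl
      intro j _
      rw [ENNReal.ofReal_sum_of_nonneg]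
      · apply Finset.sum_congr rfl
        intro k _
        rw [ENNReal.ofReal_mul (p := ρ ^ j * τ ^ (j - k)) (by positivity),
          ENNReal.ofReal_mul (p := min (A : ℝ) _) (by positivity)]
        rw [ENNReal.ofReal_min, ENNReal.ofReal_min, ENNReal.ofReal_mul (q := (A' : ℝ)) (by positivity),
          ENNReal.ofReal_mul (q := (B' : ℝ)) (by positivity)]
        simp
      · intros; positivity
    · intro j _; apply Finset.sum_nonneg; intros; positivity
  · rw [ENNReal.ofReal_mul hC.le, ENNReal.ofReal_add (by positivity) (by positivity),
      ENNReal.ofReal_mul (by positivity), ENNReal.ofReal_mul (by positivity)]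
    simp

end

section

/-! ### Weighted norms of nonnegative functions -/

def LN {n : ℕ} (p : ℝ≥0∞) (b : ℝ) (u : Eu n → ℝ≥0∞) : ℝ≥0∞ :=
  if p = ∞ then essSup (fun x => jweight b x * u x) volume
  else (∫⁻ x, (jweight b x * u x) ^ p.toReal) ^ (1 / p.toReal)

lemma kp_base_pos {n : ℕ} (x : Eu n) : 0 < 1 + ‖x‖ ^ 2 := by positivity

lemma jweight_measurable {n : ℕ} (b : ℝ) : Measurable (jweight b : Eu n → ℝ≥0∞) := by
  unfold jweight; fun_prop

lemma jweight_ne_zero {n : ℕ} (b : ℝ) (x : Eu n) : jweight b x ≠ 0 := by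
  unfold jweight
  simp only [ne_eq, ENNReal.ofReal_eq_zero, not_le]
  positivity

lemma jweight_ne_top {n : ℕ} (b : ℝ) (x : Eu n) : jweight b x ≠ ⊤ := by
  unfold jweight; exact ENNReal.ofReal_ne_top

lemma jweight_zero {n : ℕ} (x : Eu n) : jweight 0 x = 1 := by
  unfold jweight; simp

lemma jweight_add {n : ℕ} (b c : ℝ) (x : Eu n) :
    jweight (b + c) x = jweight b x * jweight c x := by
  unfold jweight
  rw [← ENNReal.ofReal_mul (by positivity), ← Real.rpow_add (kp_base_pos x)]
  congr 2; ring

lemma jweight_rpow {n : ℕ} (b q : ℝ) (x : Eu n) :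
    jweight (b * q) x = jweight b x ^ q := by
  unfold jweight
  rw [ENNReal.ofReal_rpow_of_pos (by positivity), ← Real.rpow_mul (by positivity)]
  congr 2; ring

lemma wNorm_eq_LN {n : ℕ} (p : ℝ≥0∞) (hp : p ≠ 0) (a : ℝ) (f : Eu n → ℂ) :
    wNorm p a f = LN p (a / p.toReal) (fun x => ‖f x‖ₑ) := by
  unfold wNorm LN
  split_ifs with h
  · subst h
    simp [jweight_zero]
    rfl
  · have hp' : p.toReal ≠ 0 := (ENNReal.toReal_pos hp h).ne'
    congr 2
    ext x
    rw [ENNReal.mul_rpow_of_nonneg _ _ ENNReal.toReal_nonneg, ← jweight_rpow, div_mul_cancel₀ _ hp',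
      mul_comm]
    rfl

lemma LN_mono {n : ℕ} (p : ℝ≥0∞) (b : ℝ) {u v : Eu n → ℝ≥0∞} (h : ∀ x, u x ≤ v x) :
    LN p b u ≤ LN p b v := by
  unfold LN
  split_ifs with hp
  · refine essSup_mono_ae ?_
    filter_upwards with x
    gcongr; exact h x
  · gcongr with x; exact h x

lemma LN_const_mul {n : ℕ} (p : ℝ≥0∞) (hp : p ≠ 0) (b : ℝ) (c : ℝ≥0∞) (hc : c ≠ ⊤) (u : Eu n → ℝ≥0∞) :
    LN p b (fun x => c * u x) = c * LN p b u := by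
  unfold LN
  split_ifs with h
  · rw [← ENNReal.essSup_const_mul]
    congr 1; ext x; ring
  · have hp' : 0 < p.toReal := (ENNReal.toReal_pos hp h)
    have : ∀ x, (jweight b x * (c * u x)) ^ p.toReal =
        c ^ p.toReal * (jweight b x * u x) ^ p.toReal := by
      intro x
      rw [← ENNReal.mul_rpow_of_nonneg _ _ hp'.le]; congr 1; ring
    simp_rw [this]
    rw [lintegral_const_mul' _ _ (by simp [hc, hp'.le]), ENNReal.mul_rpow_of_nonneg _ _ (by positivity),
      ← ENNReal.rpow_mul]
    congr 1
    rw [mul_one_div_cancel hp'.ne', ENNReal.rpow_one]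

lemma LN_rpow {n : ℕ} (p : ℝ≥0∞) (hp : p ≠ 0) (b q : ℝ) (hq : 0 < q) (u : Eu n → ℝ≥0∞) :
    LN (p / ENNReal.ofReal q) (b * q) (fun x => u x ^ q) = LN p b u ^ q := by
  unfold LN
  have hq' : ENNReal.ofReal q ≠ 0 := by simpa using hq
  have e : ∀ x : Eu n, jweight (b * q) x * u x ^ q = (jweight b x * u x) ^ q := by
    intro x
    rw [jweight_rpow, ENNReal.mul_rpow_of_nonneg _ _ hq.le]
  by_cases h : p = ⊤
  · subst h
    rw [ENNReal.top_div_of_ne_top ENNReal.ofReal_ne_top]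
    simp only [if_true, e]
    exact ((ENNReal.orderIsoRpow q hq).essSup_apply _ _).symm
  · rw [if_neg h, if_neg (by simp [ENNReal.div_eq_top, h, hq])]
    have hp' : 0 < p.toReal := (ENNReal.toReal_pos hp h)
    simp only [e]
    rw [ENNReal.toReal_div, ENNReal.toReal_ofReal hq.le, ← ENNReal.rpow_mul]
    congr 1
    · apply lintegral_congr
      intro x
      rw [← ENNReal.rpow_mul]; congr 1; field_simp
    · field_simp

lemma LN_add_le_one {n : ℕ} (p : ℝ≥0∞) (hp : 1 ≤ p) (b : ℝ) {u v : Eu n → ℝ≥0∞}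
    (hu : Measurable u) (hv : Measurable v) :
    LN p b (fun x => u x + v x) ≤ LN p b u + LN p b v := by
  unfold LN
  have hj := jweight_measurable (n := n) b
  split_ifs with h
  · simp only [mul_add]
    exact ENNReal.essSup_add_le _ _
  · have hp' : 1 ≤ p.toReal := by
      rw [← ENNReal.toReal_one]; exact (ENNReal.toReal_le_toReal (by simp) h).2 hp
    simp only [mul_add]
    exact ENNReal.lintegral_Lp_add_le (hj.mul hu).aemeasurable (hj.mul hv).aemeasurable hp'

lemma LN_add_rpow {n : ℕ} (p : ℝ≥0∞) (b q : ℝ) (hq : 0 < q) (hq1 : q ≤ 1)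
    (hqp : ENNReal.ofReal q ≤ p) {u v : Eu n → ℝ≥0∞}
    (hu : Measurable u) (hv : Measurable v) :
    LN p b (fun x => u x + v x) ^ q ≤ LN p b u ^ q + LN p b v ^ q := by
  have hq' : 0 < ENNReal.ofReal q := by simpa using hq
  have hp : p ≠ 0 := (hq'.trans_le hqp).ne'
  rw [← LN_rpow p hp b q hq, ← LN_rpow p hp b q hq, ← LN_rpow p hp b q hq]
  refine le_trans (LN_mono _ _ (fun x => ENNReal.rpow_add_le_add_rpow (u x) (v x) hq.le hq1)) ?_
  apply LN_add_le_one _ _ _ (hu.pow_const q) (hv.pow_const q)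
  rw [ENNReal.le_div_iff_mul_le (Or.inl hq'.ne') (Or.inl ENNReal.ofReal_ne_top), one_mul]
  exact hqp

lemma LN_zero {n : ℕ} (p : ℝ≥0∞) (hp : p ≠ 0) (b : ℝ) : LN p b (fun _ : Eu n => 0) = 0 := by
  have := LN_const_mul (n := n) p hp b 0 (by simp) (fun _ => 0)
  simpa using this

lemma LN_sum_rpow {n : ℕ} {ι : Type*} (p : ℝ≥0∞) (b q : ℝ) (hq : 0 < q) (hq1 : q ≤ 1)
    (hqp : ENNReal.ofReal q ≤ p) (s : Finset ι) {u : ι → Eu n → ℝ≥0∞}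
    (hu : ∀ i, Measurable (u i)) :
    LN p b (fun x => ∑ i ∈ s, u i x) ^ q ≤ ∑ i ∈ s, LN p b (u i) ^ q := by
  have hq' : 0 < ENNReal.ofReal q := by simpa using hq
  have hp : p ≠ 0 := (hq'.trans_le hqp).ne'
  classical
  induction s using Finset.induction_on with
  | empty => simp [LN_zero p hp b, hq]
  | insert i s his ih =>
    simp only [Finset.sum_insert his]
    refine (LN_add_rpow p b q hq hq1 hqp (hu i) (Finset.measurable_sum _ (fun i _ => hu i))).trans ?_
    gcongr

lemma LN_holder {n : ℕ} (p p₁ p₂ : ℝ≥0∞) (b₁ b₂ : ℝ) (hp : p ≠ 0) (hp1 : p₁ ≠ 0) (hp2 : p₂ ≠ 0)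
    (h : 1 / p = 1 / p₁ + 1 / p₂) {u v : Eu n → ℝ≥0∞} (hu : Measurable u) (hv : Measurable v) :
    LN p (b₁ + b₂) (fun x => u x * v x) ≤ LN p₁ b₁ u * LN p₂ b₂ v := by
  have e : ∀ x, jweight (b₁ + b₂) x * (u x * v x) = (jweight b₁ x * u x) * (jweight b₂ x * v x) := by
    intro x; rw [jweight_add]; ring
  have hU : Measurable (fun x => jweight b₁ x * u x) := (jweight_measurable b₁).mul hu
  have hV : Measurable (fun x => jweight b₂ x * v x) := (jweight_measurable b₂).mul hv
  unfold LN
  simp only [e]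
  set U := (fun x => jweight b₁ x * u x) with hUd
  set V := (fun x => jweight b₂ x * v x) with hVd
  change (if p = ⊤ then essSup (fun x => U x * V x) volume
    else (∫⁻ x, (U x * V x) ^ p.toReal) ^ (1 / p.toReal)) ≤
    (if p₁ = ⊤ then essSup U volume else (∫⁻ x, (U x) ^ p₁.toReal) ^ (1 / p₁.toReal)) *
    (if p₂ = ⊤ then essSup V volume else (∫⁻ x, (V x) ^ p₂.toReal) ^ (1 / p₂.toReal))
  have aux : ∀ (r : ℝ) (hr : 0 < r) (F G : Eu n → ℝ≥0∞), Measurable G → 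
      (∫⁻ x, (F x * G x) ^ r) ^ (1 / r) ≤ essSup F volume * (∫⁻ x, (G x) ^ r) ^ (1 / r) := by
    intro r hr F G hG
    have : ∫⁻ x, (F x * G x) ^ r ≤ (essSup F volume) ^ r * ∫⁻ x, G x ^ r := by
      rw [← lintegral_const_mul _ (hG.pow_const r)]
      apply lintegral_mono_ae
      filter_upwards [ENNReal.ae_le_essSup F] with x hx
      rw [ENNReal.mul_rpow_of_nonneg _ _ hr.le]
      gcongr
    refine (ENNReal.rpow_le_rpow this (by positivity)).trans ?_
    rw [ENNReal.mul_rpow_of_nonneg _ _ (by positivity), ← ENNReal.rpow_mul,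
      mul_one_div_cancel hr.ne', ENNReal.rpow_one]
  by_cases h1 : p₁ = ⊤
  · subst h1
    have hpp : p = p₂ := by
      simp at h; exact h
    subst hpp
    by_cases h2 : p = ⊤
    · simp only [h2, if_true]
      exact ENNReal.essSup_mul_le _ _
    · simp only [if_true, if_neg h2]
      exact aux _ (ENNReal.toReal_pos hp h2) U V hV
  by_cases h2 : p₂ = ⊤
  · subst h2
    have hpp : p = p₁ := by
      simp at h; exact h
    subst hpp
    simp only [if_true, if_neg h1]
    have := aux _ (ENNReal.toReal_pos hp h1) V U hU
    simp only [mul_comm] at this ⊢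
    exact this
  have hpt : p ≠ ⊤ := by
    rintro rfl
    rw [eq_comm] at h; simp [h1, h2] at h
  rw [if_neg hpt, if_neg h1, if_neg h2]
  have r1 := ENNReal.toReal_pos hp1 h1
  have r2 := ENNReal.toReal_pos hp2 h2
  have r0 := ENNReal.toReal_pos hp hpt
  have hreal : 1 / p.toReal = 1 / p₁.toReal + 1 / p₂.toReal := by
    have := congrArg ENNReal.toReal h
    rw [ENNReal.toReal_add (by simp [hp1]) (by simp [hp2])] at this
    simpa [ENNReal.toReal_div] using this
  have hlt : p.toReal < p₁.toReal := by
    rw [← one_div_lt_one_div r1 r0, hreal]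
    have : 0 < 1 / p₂.toReal := by positivity
    linarith
  exact ENNReal.lintegral_Lp_mul_le_Lq_mul_Lr r0 hlt hreal volume hU.aemeasurable hV.aemeasurable

lemma LN_fatou {n : ℕ} (p : ℝ≥0∞) (b : ℝ) {u : ℕ → Eu n → ℝ≥0∞} {v : Eu n → ℝ≥0∞}
    (hu : ∀ i, Measurable (u i)) (hlim : ∀ x, Filter.Tendsto (fun i => u i x) Filter.atTop (nhds (v x)))
    (K : ℝ≥0∞) (hK : ∀ i, LN p b (u i) ≤ K) : LN p b v ≤ K := by
  unfold LN at hK ⊢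
  have hl : ∀ x, Filter.Tendsto (fun i => jweight b x * u i x) Filter.atTop (nhds (jweight b x * v x)) :=
    fun x => ENNReal.Tendsto.const_mul (hlim x) (Or.inr (jweight_ne_top b x))
  by_cases h : p = ⊤
  · simp only [h, if_true] at hK ⊢
    refine essSup_le_of_ae_le _ ?_
    have : ∀ᵐ x, ∀ i, jweight b x * u i x ≤ K := by
      rw [ae_all_iff]; intro i
      filter_upwards [ENNReal.ae_le_essSup (fun x => jweight b x * u i x)] with x hx
      exact hx.trans (hK i)
    filter_upwards [this] with x hx
    exact le_of_tendsto' (hl x) hx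
  · simp only [h, if_false] at hK ⊢
    rcases eq_or_lt_of_le (ENNReal.toReal_nonneg : 0 ≤ p.toReal) with hp | hp
    · rw [← hp] at hK ⊢
      simpa using hK 0
    have hK' : ∀ i, ∫⁻ x, (jweight b x * u i x) ^ p.toReal ≤ K ^ p.toReal := by
      intro i
      have := ENNReal.rpow_le_rpow (hK i) hp.le
      rwa [← ENNReal.rpow_mul, one_div_mul_cancel hp.ne', ENNReal.rpow_one] at this
    have : ∫⁻ x, (jweight b x * v x) ^ p.toReal ≤ K ^ p.toReal := by
      have e : ∀ x, (jweight b x * v x) ^ p.toReal =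
          Filter.liminf (fun i => (jweight b x * u i x) ^ p.toReal) Filter.atTop := by
        intro x
        exact (((ENNReal.continuous_rpow_const (y := p.toReal)).tendsto _).comp (hl x)).liminf_eq.symm
      simp_rw [e]
      refine (lintegral_liminf_le (fun i => ((jweight_measurable b).mul (hu i)).pow_const _)).trans ?_
      exact Filter.liminf_le_of_frequently_le' (Filter.Frequently.of_forall hK')
    have := ENNReal.rpow_le_rpow this (by positivity : 0 ≤ 1 / p.toReal)
    rwa [← ENNReal.rpow_mul, mul_one_div_cancel hp.ne', ENNReal.rpow_one] at this

/-! ### Kernels -/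

def dk {n : ℕ} (l : ℕ) (M : ℝ) (x : Eu n) : ℝ≥0∞ := ENNReal.ofReal ((1 + 2 ^ l * ‖x‖) ^ (-M))

lemma kp_dkbase {n : ℕ} (l : ℕ) (x : Eu n) : 1 ≤ 1 + 2 ^ l * ‖x‖ := by
  have : 0 ≤ 2 ^ l * ‖x‖ := by positivity
  linarith

lemma kp_dkbase0 {n : ℕ} (l : ℕ) (x : Eu n) : 0 < 1 + 2 ^ l * ‖x‖ := by positivity

lemma dk_measurable {n : ℕ} (l : ℕ) (M : ℝ) : Measurable (dk l M : Eu n → ℝ≥0∞) := by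
  unfold dk; fun_prop

lemma dk_ne_top {n : ℕ} (l : ℕ) (M : ℝ) (x : Eu n) : dk l M x ≠ ⊤ := ENNReal.ofReal_ne_top

lemma dk_ne_zero {n : ℕ} (l : ℕ) (M : ℝ) (x : Eu n) : dk l M x ≠ 0 := by
  unfold dk
  have := kp_dkbase0 l x
  simp only [ne_eq, ENNReal.ofReal_eq_zero, not_le]
  positivity

lemma dk_mul {n : ℕ} (l : ℕ) (M M' : ℝ) (x : Eu n) : dk l M x * dk l M' x = dk l (M + M') x := by
  unfold dk
  have := kp_dkbase0 l x
  rw [← ENNReal.ofReal_mul (by positivity), ← Real.rpow_add this]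
  congr 2; ring

lemma dk_rpow {n : ℕ} (l : ℕ) (M q : ℝ) (x : Eu n) : dk l M x ^ q = dk l (M * q) x := by
  unfold dk
  have := kp_dkbase0 l x
  rw [ENNReal.ofReal_rpow_of_pos (by positivity), ← Real.rpow_mul this.le]
  congr 2; ring

lemma dk_zero {n : ℕ} (l : ℕ) (x : Eu n) : dk l 0 x = 1 := by
  unfold dk; simp

lemma dk_anti {n : ℕ} (l : ℕ) {M M' : ℝ} (h : M ≤ M') (x : Eu n) : dk l M' x ≤ dk l M x := by
  unfold dk
  apply ENNReal.ofReal_le_ofReal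
  exact Real.rpow_le_rpow_of_exponent_le (kp_dkbase l x) (by linarith)

lemma dk_le_one {n : ℕ} (l : ℕ) {M : ℝ} (h : 0 ≤ M) (x : Eu n) : dk l M x ≤ 1 := by
  have := dk_anti l h x; rwa [dk_zero] at this

lemma dk_neg {n : ℕ} (x : Eu n) {l j : ℕ} {M : ℝ} (hM : 0 ≤ M) (hlj : l ≤ j) :
    dk l (-M) x ≤ dk j (-M) x := by
  unfold dk
  apply ENNReal.ofReal_le_ofReal
  simp only [neg_neg]
  apply Real.rpow_le_rpow (by positivity) _ hM
  have : (2:ℝ) ^ l ≤ 2 ^ j := pow_le_pow_right₀ (by norm_num) hlj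
  gcongr

lemma dk_neg' {n : ℕ} (x : Eu n) {l j c : ℕ} {M : ℝ} (hM : 0 ≤ M) (hlj : l ≤ j + c) :
    dk l (-M) x ≤ (2:ℝ≥0∞) ^ (c * M) * dk j (-M) x := by
  unfold dk
  have : (2:ℝ≥0∞) ^ (c * M) = ENNReal.ofReal ((2 ^ c) ^ M) := by
    rw [← ENNReal.ofReal_rpow_of_pos (by positivity), ENNReal.ofReal_pow (by norm_num), ENNReal.rpow_mul]
    simp
  rw [this, ← ENNReal.ofReal_mul (by positivity)]
  apply ENNReal.ofReal_le_ofReal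
  simp only [neg_neg]
  rw [← Real.mul_rpow (by positivity) (by positivity)]
  apply Real.rpow_le_rpow (by positivity) _ hM
  have h1 : (2:ℝ) ^ l ≤ 2 ^ c * 2 ^ j := by
    rw [← pow_add]; exact pow_le_pow_right₀ (by norm_num) (by omega)
  have h2 : (1:ℝ) ≤ 2 ^ c := one_le_pow₀ (by norm_num)
  have := norm_nonneg x
  nlinarith

lemma dk_shift {n : ℕ} (l : ℕ) {M : ℝ} (hM : 0 ≤ M) (x y z : Eu n) :
    dk l M (x - y) ≤ dk l (-M) (y - z) * dk l M (x - z) := by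
  unfold dk
  rw [← ENNReal.ofReal_mul (by positivity)]
  apply ENNReal.ofReal_le_ofReal
  simp only [neg_neg]
  have h1 := kp_dkbase0 l (x - y)
  have h2 := kp_dkbase0 l (y - z)
  have h3 := kp_dkbase0 l (x - z)
  rw [Real.rpow_neg h1.le, Real.rpow_neg h3.le, ← div_eq_mul_inv, inv_eq_one_div, div_le_div_iff₀ (by positivity) (by positivity),
    one_mul, ← Real.mul_rpow h2.le h1.le]
  apply Real.rpow_le_rpow h3.le _ hM
  have : ‖x - z‖ ≤ ‖y - z‖ + ‖x - y‖ := by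
    have : x - z = (y - z) + (x - y) := by abel
    rw [this]; exact norm_add_le _ _
  have h4 : (2:ℝ) ^ l * ‖x - z‖ ≤ 2 ^ l * (‖y - z‖ + ‖x - y‖) := by gcongr
  have h5 : 0 ≤ (2 ^ l * ‖y - z‖) * (2 ^ l * ‖x - y‖) := by positivity
  nlinarith

lemma dk_symm {n : ℕ} (l : ℕ) (M : ℝ) (x y : Eu n) : dk l M (x - y) = dk l M (y - x) := by
  unfold dk; rw [norm_sub_rev]

def cM (n : ℕ) (M : ℝ) : ℝ≥0∞ := ∫⁻ x : Eu n, dk 0 M x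

lemma cM_ne_top {n : ℕ} {M : ℝ} (hM : (n : ℝ) < M) : cM n M ≠ ⊤ := by
  have := finite_integral_one_add_norm (E := Eu n) (μ := volume) (r := M) (by simpa using hM)
  unfold cM dk
  simpa using this.ne

lemma cM_ne_zero {n : ℕ} (M : ℝ) : cM n M ≠ 0 := by
  unfold cM
  intro h
  rw [lintegral_eq_zero_iff (dk_measurable 0 M)] at h
  have h2 : ∀ᵐ x : Eu n, False := by
    filter_upwards [h] with x hx
    exact dk_ne_zero 0 M x hx
  simp at h2
  exact (NeZero.ne (volume : Measure (Eu n))) h2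

lemma dk_lintegral {n : ℕ} (l : ℕ) (M : ℝ) :
    ∫⁻ x : Eu n, dk l M x = (2:ℝ≥0∞) ^ (-(l * n : ℝ)) * cM n M := by
  have h2 : ((2:ℝ) ^ l) ≠ 0 := by positivity
  have e : ∀ x : Eu n, dk l M x = dk 0 M (((2:ℝ) ^ l) • x) := by
    intro x; unfold dk; rw [norm_smul]; simp
  simp_rw [e]
  rw [← lintegral_map (f := dk 0 M) (dk_measurable 0 M) (measurable_const_smul _),
    Measure.map_addHaar_smul _ h2, lintegral_smul_measure]
  unfold cM
  rw [smul_eq_mul]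
  congr 1
  rw [abs_of_pos (by positivity), ENNReal.ofReal_inv_of_pos (by positivity), ENNReal.rpow_neg]
  congr 1
  rw [← pow_mul, ENNReal.ofReal_pow (by norm_num)]
  have : ((l:ℝ) * n) = ((l * n : ℕ) : ℝ) := by push_cast; ring
  rw [this, ENNReal.rpow_natCast]
  simp

lemma dk_lintegral_sub {n : ℕ} (l : ℕ) (M : ℝ) (x : Eu n) :
    ∫⁻ y : Eu n, dk l M (x - y) = (2:ℝ≥0∞) ^ (-(l * n : ℝ)) * cM n M := by
  rw [← dk_lintegral, lintegral_sub_left_eq_self (fun y => dk l M y) x]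

lemma jweight_shift {n : ℕ} {b : ℝ} (hb : 0 ≤ b) (l : ℕ) (x y : Eu n) :
    jweight b x ≤ (2:ℝ≥0∞) ^ (b / 2) * (dk l (-b) (x - y) * jweight b y) := by
  have h0 : dk 0 (-b) (x - y) ≤ dk l (-b) (x - y) := dk_neg _ hb (Nat.zero_le _)
  refine le_trans ?_ (mul_le_mul_right (mul_le_mul_left h0 _) _)
  unfold dk jweight
  have : (2:ℝ≥0∞) ^ (b / 2) = ENNReal.ofReal (2 ^ (b / 2)) := by
    rw [← ENNReal.ofReal_rpow_of_pos (by positivity)]; simp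
  rw [this, ← ENNReal.ofReal_mul (by positivity), ← ENNReal.ofReal_mul (by positivity)]
  apply ENNReal.ofReal_le_ofReal
  have h1 : (1 + 2 ^ 0 * ‖x - y‖) ^ (- -b) = ((1 + ‖x - y‖) ^ 2) ^ (b / 2) := by
    rw [pow_zero, one_mul, neg_neg, ← Real.rpow_natCast, ← Real.rpow_mul (by positivity)]
    congr 1; push_cast; ring
  rw [h1, ← Real.mul_rpow (by positivity) (by positivity), ← Real.mul_rpow (by positivity) (by positivity)]
  apply Real.rpow_le_rpow (by positivity) _ (by positivity)
  have hx : ‖x‖ ≤ ‖x - y‖ + ‖y‖ := by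
    have : x = (x - y) + y := by abel
    conv_lhs => rw [this]
    exact norm_add_le _ _
  have h2 := norm_nonneg x
  have h3 := norm_nonneg y
  have h4 := norm_nonneg (x - y)
  have h5 : ‖x‖ ^ 2 ≤ 2 * ‖x - y‖ ^ 2 + 2 * ‖y‖ ^ 2 := by nlinarith [sq_nonneg (‖x - y‖ - ‖y‖)]
  nlinarith [mul_nonneg h4 (sq_nonneg ‖y‖), mul_nonneg (sq_nonneg ‖x - y‖) (sq_nonneg ‖y‖)]

lemma kp_jensen {n : ℕ} (r : ℝ) (hr : 1 ≤ r) {k v : Eu n → ℝ≥0∞} (hk : Measurable k) (hv : Measurable v) :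
    (∫⁻ y, k y * v y) ^ r ≤ (∫⁻ y, k y) ^ (r - 1) * ∫⁻ y, k y * v y ^ r := by
  rcases hr.eq_or_lt with h | h
  · subst h; simp
  have hr0 : 0 < r := by linarith
  have hc := (Real.HolderConjugate.conjExponent h).symm
  set r' := Real.conjExponent r with hr'
  have hr'0 : 0 < r' := hc.pos
  have hinv : 1 / r' = 1 - 1 / r := by
    have := hc.inv_add_inv_eq_one
    rw [one_div, one_div]; linarith
  have hle : 0 ≤ 1 - 1 / r := by rw [← hinv]; positivity
  have e : ∀ y, k y * v y = (k y ^ (1 - 1 / r)) * (k y ^ (1 / r) * v y) := by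
    intro y
    rw [← mul_assoc, ← ENNReal.rpow_add_of_nonneg _ _ hle (by positivity)]
    simp
  have := ENNReal.lintegral_mul_le_Lp_mul_Lq volume hc (f := fun y => k y ^ (1 - 1 / r))
    (g := fun y => k y ^ (1 / r) * v y) (hk.pow_const _).aemeasurable
    ((hk.pow_const _).mul hv).aemeasurable
  simp only [Pi.mul_apply, ← e] at this
  refine (ENNReal.rpow_le_rpow this hr0.le).trans ?_
  rw [ENNReal.mul_rpow_of_nonneg _ _ hr0.le, ← ENNReal.rpow_mul, ← ENNReal.rpow_mul,
    one_div_mul_cancel hr0.ne', ENNReal.rpow_one, hinv]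
  have e1 : (1 - 1 / r) * r = r - 1 := by field_simp
  have e2 : ∀ y, (k y ^ (1 - 1 / r)) ^ r' = k y := by
    intro y
    rw [← ENNReal.rpow_mul, ← hinv, one_div_mul_cancel hr'0.ne', ENNReal.rpow_one]
  have e3 : ∀ y, (k y ^ (1 / r) * v y) ^ r = k y * v y ^ r := by
    intro y
    rw [ENNReal.mul_rpow_of_nonneg _ _ hr0.le, ← ENNReal.rpow_mul, one_div_mul_cancel hr0.ne', ENNReal.rpow_one]
  simp_rw [e1, e2, e3]
  rfl

lemma kp_measurable_conv {n : ℕ} {k v : Eu n → ℝ≥0∞} (hk : Measurable k) (hv : Measurable v) :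
    Measurable (fun x => ∫⁻ y, k (x - y) * v y) := by
  apply Measurable.lintegral_prod_right' (f := fun z : Eu n × Eu n => k (z.1 - z.2) * v z.2)
  fun_prop

lemma LN_young {n : ℕ} (r : ℝ≥0∞) (hr : 1 ≤ r) (b : ℝ) (hb : 0 ≤ b) (M : ℝ) (l : ℕ)
    {u : Eu n → ℝ≥0∞} (hu : Measurable u) :
    LN r b (fun x => ∫⁻ y, dk l M (x - y) * u y) ≤
      (2:ℝ≥0∞) ^ (b / 2) * ((2:ℝ≥0∞) ^ (-(l * n : ℝ)) * cM n (M - b)) * LN r b u := by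
  set v := fun x => jweight b x * u x with hv
  have hvm : Measurable v := (jweight_measurable b).mul hu
  set K := (2:ℝ≥0∞) ^ (-(l * n : ℝ)) * cM n (M - b) with hK
  have hkm : Measurable (dk l (M - b) : Eu n → ℝ≥0∞) := dk_measurable _ _
  have hk1 : ∀ x : Eu n, Measurable (fun y => dk l (M - b) (x - y)) := fun x =>
    hkm.comp (measurable_const.sub measurable_id)
  have hk2 : ∀ y : Eu n, Measurable (fun x => dk l (M - b) (x - y)) := fun x =>
    hkm.comp (measurable_id.sub measurable_const)
  have h1 : ∀ x, jweight b x * ∫⁻ y, dk l M (x - y) * u y ≤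
      (2:ℝ≥0∞) ^ (b / 2) * ∫⁻ y, dk l (M - b) (x - y) * v y := by
    intro x
    rw [← lintegral_const_mul' _ _ (jweight_ne_top b x), ← lintegral_const_mul' _ _ (by simp)]
    apply lintegral_mono
    intro y
    calc jweight b x * (dk l M (x - y) * u y) ≤
        ((2:ℝ≥0∞) ^ (b / 2) * (dk l (-b) (x - y) * jweight b y)) * (dk l M (x - y) * u y) := by
          gcongr; exact jweight_shift hb l x y
      _ = (2:ℝ≥0∞) ^ (b / 2) * ((dk l M (x - y) * dk l (-b) (x - y)) * (jweight b y * u y)) := by ring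
      _ = _ := by rw [dk_mul]; rfl
  unfold LN
  change (if r = ⊤ then _ else _) ≤ _ * (if r = ⊤ then essSup v volume else (∫⁻ x, (v x) ^ r.toReal) ^ (1 / r.toReal))
  split_ifs with h
  · refine essSup_le_of_ae_le _ ?_
    filter_upwards with x
    refine (h1 x).trans ?_
    rw [mul_assoc]
    gcongr
    calc _ ≤ ∫⁻ y, dk l (M - b) (x - y) * essSup v volume := by
          apply lintegral_mono_ae
          filter_upwards [ENNReal.ae_le_essSup v] with y hy
          gcongr
      _ = _ := by
          rw [lintegral_mul_const _ (hk1 x), dk_lintegral_sub]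
  · have hr' : 1 ≤ r.toReal := by
      rw [← ENNReal.toReal_one]; exact (ENNReal.toReal_le_toReal (by simp) h).2 hr
    set t := r.toReal with ht
    have ht0 : 0 < t := by linarith
    have h2 : ∫⁻ x, (jweight b x * ∫⁻ y, dk l M (x - y) * u y) ^ t ≤
        ((2:ℝ≥0∞) ^ (b / 2) * K) ^ t * ∫⁻ x, v x ^ t := by
      calc _ ≤ ∫⁻ x, ((2:ℝ≥0∞) ^ (b / 2)) ^ t * (K ^ (t - 1) * ∫⁻ y, dk l (M - b) (x - y) * v y ^ t) := by
            apply lintegral_mono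
            intro x
            refine (ENNReal.rpow_le_rpow (h1 x) ht0.le).trans ?_
            rw [ENNReal.mul_rpow_of_nonneg _ _ ht0.le]
            refine mul_le_mul_right ?_ _
            refine (kp_jensen t hr' (hk1 x) hvm).trans ?_
            rw [dk_lintegral_sub]
        _ = ((2:ℝ≥0∞) ^ (b / 2)) ^ t * (K ^ (t - 1) * (K * ∫⁻ y, v y ^ t)) := by
            have hcm := kp_measurable_conv hkm (hvm.pow_const t)
            rw [lintegral_const_mul _ (hcm.const_mul _), lintegral_const_mul _ hcm]
            congr 2
            rw [lintegral_lintegral_swap]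
            · have : ∀ y, ∫⁻ x, dk l (M - b) (x - y) * v y ^ t = K * v y ^ t := by
                intro y
                rw [lintegral_mul_const _ (hk2 y)]
                simp_rw [dk_symm l (M - b) _ y]
                rw [dk_lintegral_sub]
              simp_rw [this]
              rw [lintegral_const_mul _ (hvm.pow_const t)]
            · apply Measurable.aemeasurable
              apply Measurable.mul
              · exact hkm.comp (measurable_fst.sub measurable_snd)
              · exact (hvm.pow_const t).comp measurable_snd
        _ = _ := by
            rw [ENNReal.mul_rpow_of_nonneg _ _ ht0.le]
            have : K ^ t = K ^ (t - 1) * K := by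
              conv_rhs => rw [← ENNReal.rpow_one K, ← ENNReal.rpow_mul, one_mul]
              rw [← ENNReal.rpow_add_of_nonneg _ _ (by linarith) (by norm_num)]
              congr 1; ring
            rw [this]; ring
    refine (ENNReal.rpow_le_rpow h2 (by positivity : 0 ≤ 1 / t)).trans ?_
    rw [ENNReal.mul_rpow_of_nonneg _ _ (by positivity), ← ENNReal.rpow_mul, mul_one_div_cancel ht0.ne',
      ENNReal.rpow_one]

end

section

/-! ### Powers of two and the Peetre type estimate -/

def tw (x : ℝ) : ℝ≥0∞ := (2:ℝ≥0∞) ^ x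

lemma tw_add (x y : ℝ) : tw (x + y) = tw x * tw y := ENNReal.rpow_add _ _ (by simp) (by simp)
lemma tw_ne_top (x : ℝ) : tw x ≠ ⊤ := by unfold tw; simp
lemma tw_ne_zero (x : ℝ) : tw x ≠ 0 := by unfold tw; simp
lemma tw_zero : tw 0 = 1 := by unfold tw; simp
lemma tw_rpow (x y : ℝ) : tw x ^ y = tw (x * y) := by unfold tw; rw [ENNReal.rpow_mul]
lemma tw_mono {x y : ℝ} (h : x ≤ y) : tw x ≤ tw y :=
  ENNReal.rpow_le_rpow_of_exponent_le (by norm_num) h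
lemma tw_ofReal (x : ℝ) : tw x = ENNReal.ofReal ((2:ℝ) ^ x) := by
  unfold tw; rw [← ENNReal.ofReal_rpow_of_pos (by norm_num)]; simp
lemma tw_nat (k : ℕ) : tw k = ENNReal.ofReal ((2:ℝ) ^ k) := by
  rw [tw_ofReal, Real.rpow_natCast]
lemma one_le_tw {x : ℝ} (h : 0 ≤ x) : 1 ≤ tw x := by rw [← tw_zero]; exact tw_mono h

lemma kp_peetre_pt {n : ℕ} (q T M : ℝ) (hq : 0 < q) (hT : 0 ≤ T) (hM : 0 ≤ M) :
    ∃ C : ℝ≥0∞, C ≠ ⊤ ∧ ∀ l j : ℕ, l ≤ j + 2 → ∀ W : Eu n → ℝ≥0∞, Measurable W →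
      (∀ y z, W y ≤ dk j (-T) (y - z) * W z) → ∀ x y,
      dk l M (x - y) * W y ^ q ≤ C * tw (j * n) * ∫⁻ z, dk l M (x - z) * W z ^ q := by
  set L : ℝ := M + T * q + n + 1 with hL
  have hLn : (n:ℝ) < L := by have : 0 ≤ T * q := by positivity
                             linarith
  have hc0 := cM_ne_zero (n := n) L
  have hct := cM_ne_top (n := n) hLn
  refine ⟨(cM n L)⁻¹ * (2:ℝ≥0∞) ^ ((2:ℕ) * M), ENNReal.mul_ne_top (by simpa using hc0) (by simp; ), ?_⟩
  intro l j hlj W hW hWs x y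
  have key : ∀ z, (dk l M (x - y) * W y ^ q) * dk j L (y - z) ≤
      (2:ℝ≥0∞) ^ ((2:ℕ) * M) * (dk l M (x - z) * W z ^ q) := by
    intro z
    have h1 : dk l M (x - y) ≤ (2:ℝ≥0∞) ^ ((2:ℕ) * M) * dk j (-M) (y - z) * dk l M (x - z) :=
      (dk_shift l hM x y z).trans (mul_le_mul_left (dk_neg' (y - z) hM hlj) _)
    have h2 : W y ^ q ≤ dk j (-(T * q)) (y - z) * W z ^ q := by
      refine (ENNReal.rpow_le_rpow (hWs y z) hq.le).trans ?_
      rw [ENNReal.mul_rpow_of_nonneg _ _ hq.le, dk_rpow, neg_mul]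
    have h3 : dk j (-M) (y - z) * dk j (-(T * q)) (y - z) * dk j L (y - z) ≤ 1 := by
      rw [dk_mul, dk_mul]
      apply dk_le_one
      rw [hL]; have : (0:ℝ) ≤ n := by positivity
      linarith
    calc _ ≤ ((2:ℝ≥0∞) ^ ((2:ℕ) * M) * dk j (-M) (y - z) * dk l M (x - z)) *
            (dk j (-(T * q)) (y - z) * W z ^ q) * dk j L (y - z) := by gcongr
      _ = (2:ℝ≥0∞) ^ ((2:ℕ) * M) * (dk l M (x - z) * W z ^ q) *
          (dk j (-M) (y - z) * dk j (-(T * q)) (y - z) * dk j L (y - z)) := by ring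
      _ ≤ (2:ℝ≥0∞) ^ ((2:ℕ) * M) * (dk l M (x - z) * W z ^ q) * 1 := by gcongr
      _ = _ := by rw [mul_one]
  have hm : Measurable (fun z => dk j L (y - z)) :=
    (dk_measurable j L).comp (measurable_const.sub measurable_id)
  have := lintegral_mono (μ := volume) key
  rw [lintegral_const_mul _ hm, dk_lintegral_sub, lintegral_const_mul' _ _ (by simp)] at this
  change _ * (tw _ * _) ≤ _ at this
  set I := ∫⁻ z, dk l M (x - z) * W z ^ q
  have e : (tw (-(j * n : ℝ)) * cM n L) * ((cM n L)⁻¹ * tw (j * n)) = 1 := by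
    calc _ = (tw (-(j * n : ℝ)) * tw (j * n)) * (cM n L * (cM n L)⁻¹) := by ring
      _ = 1 := by rw [← tw_add, ENNReal.mul_inv_cancel hc0 hct]; simp [tw_zero]
  calc _ = dk l M (x - y) * W y ^ q * ((tw (-(j * n : ℝ)) * cM n L) * ((cM n L)⁻¹ * tw (j * n))) := by
        rw [e, mul_one]
    _ = (dk l M (x - y) * W y ^ q * (tw (-(j * n : ℝ)) * cM n L)) * ((cM n L)⁻¹ * tw (j * n)) := by ring
    _ ≤ ((2:ℝ≥0∞) ^ ((2:ℕ) * M) * I) * ((cM n L)⁻¹ * tw (j * n)) := by gcongr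
    _ = _ := by ring

lemma kp_peetre_LN {n : ℕ} (p : ℝ≥0∞) (q b T M : ℝ) (hq : 0 < q) (hq1 : q ≤ 1)
    (hqp : ENNReal.ofReal q ≤ p) (hb : 0 ≤ b) (hT : 0 ≤ T) (hM : (n:ℝ) < (M - b) * q) :
    ∃ C : ℝ≥0∞, C ≠ ⊤ ∧ ∀ l j : ℕ, l ≤ j + 2 → ∀ W : Eu n → ℝ≥0∞, Measurable W →
      (∀ y z, W y ≤ dk j (-T) (y - z) * W z) →
      LN p b (fun x => tw (l * n) * ∫⁻ y, dk l M (x - y) * W y) ≤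
        C * tw (((j:ℝ) - l) * (n * (1 / q - 1))) * LN p b W := by
  have hM0 : 0 ≤ M := by
    by_contra h
    have h2 : (M - b) * q < 0 := mul_neg_of_neg_of_pos (by linarith) hq
    have : (0:ℝ) ≤ n := by positivity
    linarith
  have hq0 : 0 < ENNReal.ofReal q := by simpa using hq
  have hp : p ≠ 0 := (hq0.trans_le hqp).ne'
  have hθ : 0 ≤ 1 / q - 1 := by
    have : 1 ≤ 1 / q := by rw [le_div_iff₀ hq]; linarith
    linarith
  obtain ⟨C, hC, hP⟩ := kp_peetre_pt (n := n) q T (M * q) hq hT (by positivity)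
  have hcn : cM n (M * q - b * q) ≠ ⊤ := cM_ne_top (by rw [← sub_mul]; exact hM)
  refine ⟨C ^ (1 / q - 1) * ((2:ℝ≥0∞) ^ (b * q / 2) * cM n (M * q - b * q)) ^ (1 / q),
    ENNReal.mul_ne_top (ENNReal.rpow_ne_top_of_nonneg hθ hC) (ENNReal.rpow_ne_top_of_nonneg (by positivity) (ENNReal.mul_ne_top (by simp) hcn)), ?_⟩
  intro l j hlj W hW hWs
  set A : Eu n → ℝ≥0∞ := fun x => ∫⁻ z, dk l (M * q) (x - z) * W z ^ q with hA
  have hptw : ∀ x, tw (l * n) * ∫⁻ y, dk l M (x - y) * W y ≤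
      (tw (l * n) * (C * tw (j * n)) ^ (1 / q - 1)) * A x ^ (1 / q) := by
    intro x
    rw [mul_assoc]
    refine mul_le_mul_right ?_ _
    have e : ∀ y, dk l M (x - y) * W y ≤ (C * tw (j * n) * A x) ^ (1 / q - 1) *
        (dk l (M * q) (x - y) * W y ^ q) := by
      intro y
      have : dk l M (x - y) * W y = (dk l (M * q) (x - y) * W y ^ q) ^ (1 / q - 1) *
        (dk l (M * q) (x - y) * W y ^ q) := by
        conv_rhs => rw [← ENNReal.rpow_one (dk l (M * q) (x - y) * W y ^ q), ← ENNReal.rpow_mul, one_mul]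
        rw [← ENNReal.rpow_add_of_nonneg _ _ hθ (by norm_num), sub_add_cancel,
          ENNReal.mul_rpow_of_nonneg _ _ (by positivity), dk_rpow, ← ENNReal.rpow_mul]
        have e1 : M * q * (1 / q) = M := by field_simp
        have e2 : q * (1 / q) = 1 := by field_simp
        rw [e1, e2, ENNReal.rpow_one]
      rw [this]
      exact mul_le_mul_left (ENNReal.rpow_le_rpow (hP l j hlj W hW hWs x y) hθ) _
    have hmm : Measurable (fun y => dk l (M * q) (x - y) * W y ^ q) :=
      ((dk_measurable _ _).comp (measurable_const.sub measurable_id)).mul (hW.pow_const q)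
    refine (lintegral_mono e).trans ?_
    rw [lintegral_const_mul _ hmm]
    change (C * tw (j * n) * A x) ^ (1 / q - 1) * A x ≤ _
    rw [ENNReal.mul_rpow_of_nonneg _ _ hθ, mul_assoc]
    refine mul_le_mul_right ?_ _
    conv_lhs => rw [← ENNReal.rpow_one (A x), ← ENNReal.rpow_mul, one_mul]
    rw [← ENNReal.rpow_add_of_nonneg _ _ hθ (by norm_num), sub_add_cancel]
  refine (LN_mono p b hptw).trans ?_
  have hfin : tw (l * n) * (C * tw (j * n)) ^ (1 / q - 1) ≠ ⊤ :=
    ENNReal.mul_ne_top (tw_ne_top _) (ENNReal.rpow_ne_top_of_nonneg hθ (ENNReal.mul_ne_top hC (tw_ne_top _)))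
  rw [LN_const_mul p hp b _ hfin]
  have hN : LN p b (fun x => A x ^ (1 / q)) = LN (p / ENNReal.ofReal q) (b * q) A ^ (1 / q) := by
    have := LN_rpow p hp b q hq (fun x => A x ^ (1 / q))
    have e : ∀ x, (A x ^ (1 / q)) ^ q = A x := by
      intro x; rw [← ENNReal.rpow_mul, one_div_mul_cancel hq.ne', ENNReal.rpow_one]
    simp only [e] at this
    rw [this, ← ENNReal.rpow_mul, mul_one_div_cancel hq.ne', ENNReal.rpow_one]
  have hr : 1 ≤ p / ENNReal.ofReal q := by
    rw [ENNReal.le_div_iff_mul_le (Or.inl hq0.ne') (Or.inl ENNReal.ofReal_ne_top), one_mul]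
    exact hqp
  have hY := LN_young (p / ENNReal.ofReal q) hr (b * q) (by positivity) (M * q) l (hW.pow_const q)
  rw [LN_rpow p hp b q hq W] at hY
  rw [hN]
  refine (mul_le_mul_right (ENNReal.rpow_le_rpow hY (by positivity : 0 ≤ 1 / q)) _).trans ?_
  apply le_of_eq
  change _ * (_ * (tw _ * _) * _) ^ _ = _
  have hq' : 0 ≤ 1 / q := by positivity
  rw [ENNReal.mul_rpow_of_nonneg _ _ hq', ENNReal.mul_rpow_of_nonneg _ _ hq', ENNReal.mul_rpow_of_nonneg _ _ hq',
    ENNReal.mul_rpow_of_nonneg _ _ hθ, ENNReal.mul_rpow_of_nonneg _ _ hq', tw_rpow, tw_rpow,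
    ← ENNReal.rpow_mul (LN p b W), mul_one_div_cancel hq.ne', ENNReal.rpow_one]
  have : tw (((j:ℝ) - l) * (n * (1 / q - 1))) = tw (l * n) * tw (j * n * (1 / q - 1)) * tw (-(l * n : ℝ) * (1 / q)) := by
    rw [← tw_add, ← tw_add]; congr 1; ring
  rw [this]; ring

/-! ### Dominated functions and commutators -/

def KB {n : ℕ} (C : ℝ≥0∞) (l : ℕ) (K : ℝ) (κ : Eu n → ℂ) : Prop :=
  ∀ x, ‖κ x‖ₑ ≤ C * tw (l * n) * dk l K x

def KD {n : ℕ} (C : ℝ≥0∞) (l : ℕ) (K : ℝ) (κ : Eu n → ℂ) : Prop :=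
  ∀ x y, ‖κ x - κ y‖ₑ ≤ C * tw (l * n) * (ENNReal.ofReal (2 ^ l * ‖x - y‖) * dk l (-K) (x - y) * dk l K y)

structure Dom {n : ℕ} (k : ℕ) (N : ℝ) (F : Eu n → ℂ) (U : Eu n → ℝ≥0∞) : Prop where
  meas : Measurable U
  bd : ∀ x, ‖F x‖ₑ ≤ U x
  slow : ∀ y z, U y ≤ dk k (-N) (y - z) * U z
  diff : ∀ x y, ‖F x - F y‖ₑ ≤ ENNReal.ofReal (2 ^ k * ‖x - y‖) * dk k (-N) (x - y) * U y

lemma kp_conv_le {n : ℕ} {C : ℝ≥0∞} {l : ℕ} {K : ℝ} {κ h : Eu n → ℂ} (hC : C ≠ ⊤) (hκ : KB C l K κ) (x : Eu n) :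
    ‖∫ y, κ (x - y) * h y‖ₑ ≤ C * tw (l * n) * ∫⁻ y, dk l K (x - y) * ‖h y‖ₑ := by
  refine (enorm_integral_le_lintegral_enorm _).trans ?_
  rw [← lintegral_const_mul' _ _ (ENNReal.mul_ne_top hC (tw_ne_top _))]
  apply lintegral_mono
  intro y
  simp only [enorm_mul]
  rw [← mul_assoc]
  gcongr
  exact hκ _

lemma kp_conv_dom {n : ℕ} {C c : ℝ≥0∞} {k : ℕ} {N : ℝ} (hN : 0 ≤ N) {κ h : Eu n → ℂ} (hC : C ≠ ⊤) (hc : c ≠ ⊤)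
    (hκ : KB C k N κ) (hκ' : KD C k N κ) (hh : Measurable h)
    (hi : ∀ x, Integrable (fun y => κ (x - y) * h y)) (F : Eu n → ℂ)
    (hF : ∀ x x', ‖F x - F x'‖ₑ ≤ c * ‖(∫ y, κ (x - y) * h y) - ∫ y, κ (x' - y) * h y‖ₑ)
    (hF0 : ∀ x, ‖F x‖ₑ ≤ c * ‖∫ y, κ (x - y) * h y‖ₑ) :
    Dom k N F (fun x => c * (C * tw (k * n)) * ∫⁻ y, dk k N (x - y) * ‖h y‖ₑ) := by
  have hhm : Measurable (fun y => ‖h y‖ₑ) := hh.enorm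
  constructor
  · exact (kp_measurable_conv (dk_measurable k N) hhm).const_mul _
  · intro x
    refine (hF0 x).trans ?_
    rw [mul_assoc]
    gcongr
    exact kp_conv_le hC hκ x
  · intro y z
    have : ∫⁻ w, dk k N (y - w) * ‖h w‖ₑ ≤ dk k (-N) (y - z) * ∫⁻ w, dk k N (z - w) * ‖h w‖ₑ := ?_
    · refine (mul_le_mul_right this _).trans (le_of_eq ?_)
      ring
    rw [← lintegral_const_mul' _ _ (dk_ne_top _ _ _)]
    apply lintegral_mono
    intro w
    simp only
    rw [← mul_assoc]
    gcongr
    rw [dk_symm k N y w, dk_symm k N z w]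
    exact dk_shift k hN w y z
  · intro x y
    refine (hF x y).trans ?_
    rw [← integral_sub (hi x) (hi y)]
    have : ‖∫ w, κ (x - w) * h w - κ (y - w) * h w‖ₑ ≤ C * tw (k * n) * (ENNReal.ofReal (2 ^ k * ‖x - y‖) * dk k (-N) (x - y)) * ∫⁻ w, dk k N (y - w) * ‖h w‖ₑ := by
      refine (enorm_integral_le_lintegral_enorm _).trans ?_
      rw [← lintegral_const_mul' _ _ (ENNReal.mul_ne_top (ENNReal.mul_ne_top hC (tw_ne_top _)) (ENNReal.mul_ne_top ENNReal.ofReal_ne_top (dk_ne_top _ _ _)))]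
      apply lintegral_mono
      intro w
      simp only [← sub_mul, enorm_mul]
      rw [← mul_assoc]
      refine mul_le_mul_left ?_ _
      have := hκ' (x - w) (y - w)
      rw [sub_sub_sub_cancel_right] at this
      refine this.trans (le_of_eq ?_)
      ring
    refine (mul_le_mul_right this _).trans (le_of_eq ?_)
    ring

end

section

lemma kp_of_rpow_le {X Z c : ℝ≥0∞} {q : ℝ} (hq : 0 < q) (h : X ^ q ≤ c * Z ^ q) : X ≤ c ^ (1 / q) * Z := by
  have := ENNReal.rpow_le_rpow h (by positivity : 0 ≤ 1 / q)
  rwa [ENNReal.mul_rpow_of_nonneg _ _ (by positivity), ← ENNReal.rpow_mul, ← ENNReal.rpow_mul,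
    mul_one_div_cancel hq.ne', ENNReal.rpow_one, ENNReal.rpow_one] at this

lemma LN_add_le_of {n : ℕ} (p : ℝ≥0∞) (b q : ℝ) (hq : 0 < q) (hq1 : q ≤ 1)
    (hqp : ENNReal.ofReal q ≤ p) {u v : Eu n → ℝ≥0∞}
    (hu : Measurable u) (hv : Measurable v) (Z : ℝ≥0∞) (h1 : LN p b u ≤ Z) (h2 : LN p b v ≤ Z) :
    LN p b (fun x => u x + v x) ≤ (2:ℝ≥0∞) ^ (1 / q) * Z := by
  apply kp_of_rpow_le hq
  refine (LN_add_rpow p b q hq hq1 hqp hu hv).trans ?_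
  rw [two_mul]
  gcongr

lemma kp_comm_pt1 {n : ℕ} {Cκ : ℝ≥0∞} (hC : Cκ ≠ ⊤) {l k j : ℕ} (hkl : k ≤ l) {M N : ℝ} (hN : 0 ≤ N) {κ F G : Eu n → ℂ}
    {U V : Eu n → ℝ≥0∞} (hκ : KB Cκ l M κ) (hF : Dom k N F U) (hG : Dom j N G V)
    (hi1 : ∀ x, Integrable (fun y => κ (x - y) * G y))
    (hi2 : ∀ x, Integrable (fun y => κ (x - y) * (F y * G y))) (x : Eu n) :
    ‖(∫ y, κ (x - y) * (F y * G y)) - F x * ∫ y, κ (x - y) * G y‖ₑ ≤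
      Cκ * tw (-((l - k : ℕ) : ℝ)) * (tw (l * n) * ∫⁻ y, dk l (M - N - 1) (x - y) * (U y * V y)) := by
  rw [← integral_const_mul, ← integral_sub (hi2 x) ((hi1 x).const_mul _)]
  refine (enorm_integral_le_lintegral_enorm _).trans ?_
  rw [← mul_assoc, ← lintegral_const_mul' _ _ (ENNReal.mul_ne_top (ENNReal.mul_ne_top hC (tw_ne_top _)) (tw_ne_top _))]
  apply lintegral_mono
  intro y
  have e : κ (x - y) * (F y * G y) - F x * (κ (x - y) * G y) = κ (x - y) * (F y - F x) * G y := by ring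
  simp only [e, enorm_mul]
  have h1 := hκ (x - y)
  have h2 : ‖F y - F x‖ₑ ≤ (tw (-((l - k : ℕ) : ℝ)) * dk l (-(N + 1)) (x - y)) * U y := by
    rw [enorm_sub_rev]
    refine (hF.diff x y).trans ?_
    refine mul_le_mul_left ?_ _
    have a1 : ENNReal.ofReal (2 ^ k * ‖x - y‖) ≤ tw (-((l - k : ℕ) : ℝ)) * dk l (-1) (x - y) := by
      rw [tw_ofReal]; unfold dk
      rw [← ENNReal.ofReal_mul (by positivity)]
      apply ENNReal.ofReal_le_ofReal
      rw [neg_neg, Real.rpow_one]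
      have : (2:ℝ) ^ k = 2 ^ (-((l - k : ℕ) : ℝ)) * 2 ^ l := by
        rw [← Real.rpow_natCast, ← Real.rpow_natCast, ← Real.rpow_add (by norm_num)]
        congr 1; push_cast [hkl]; ring
      rw [this, mul_assoc]
      gcongr
      linarith
    have a2 : dk k (-N) (x - y) ≤ dk l (-N) (x - y) := dk_neg _ hN hkl
    calc _ ≤ (tw (-((l - k : ℕ) : ℝ)) * dk l (-1) (x - y)) * dk l (-N) (x - y) := by gcongr
      _ = _ := by rw [mul_assoc, dk_mul]; congr 2; ring
  have h3 := hG.bd y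
  have h4 : dk l (M - N - 1) (x - y) = dk l M (x - y) * dk l (-(N + 1)) (x - y) := by
    rw [dk_mul]; congr 1; ring
  rw [h4]
  calc _ ≤ (Cκ * tw (l * n) * dk l M (x - y)) * ((tw (-((l - k : ℕ) : ℝ)) * dk l (-(N + 1)) (x - y)) * U y) * V y := by
        gcongr
    _ = _ := by ring

lemma kp_comm_pt2 {n : ℕ} {Cκ : ℝ≥0∞} (hC : Cκ ≠ ⊤) {l k j : ℕ} {M N : ℝ} {κ F G : Eu n → ℂ}
    {U V : Eu n → ℝ≥0∞} (hκ : KB Cκ l M κ) (hF : Dom k N F U) (hG : Dom j N G V) (x : Eu n) :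
    ‖(∫ y, κ (x - y) * (F y * G y)) - F x * ∫ y, κ (x - y) * G y‖ₑ ≤
      Cκ * (tw (l * n) * ∫⁻ y, dk l M (x - y) * (U y * V y)) +
      Cκ * (U x * (tw (l * n) * ∫⁻ y, dk l M (x - y) * V y)) := by
  refine enorm_sub_le.trans ?_
  rw [enorm_mul]
  have h1 := kp_conv_le (h := fun y => F y * G y) hC hκ x
  have h2 := kp_conv_le (h := G) hC hκ x
  have h1' : ∫⁻ y, dk l M (x - y) * ‖F y * G y‖ₑ ≤ ∫⁻ y, dk l M (x - y) * (U y * V y) := by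
    gcongr with y
    rw [enorm_mul]
    gcongr
    · exact hF.bd y
    · exact hG.bd y
  have h2' : ∫⁻ y, dk l M (x - y) * ‖G y‖ₑ ≤ ∫⁻ y, dk l M (x - y) * V y := by
    gcongr with y
    exact hG.bd y
  apply add_le_add
  · refine h1.trans ?_
    rw [mul_assoc]
    gcongr
  · calc _ ≤ U x * (Cκ * tw (l * n) * ∫⁻ y, dk l M (x - y) * V y) := by
          gcongr
          · exact hF.bd x
          · exact h2.trans (by gcongr)
      _ = _ := by ring

lemma kp_comm_LN {n : ℕ} (p p₁ p₂ : ℝ≥0∞) (b₁ b₂ q N M : ℝ) (hq : 0 < q) (hq1 : q ≤ 1)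
    (hqp : ENNReal.ofReal q ≤ p) (hp1 : 1 ≤ p₁) (hp2 : 1 ≤ p₂)
    (hexp : 1 / p = 1 / p₁ + 1 / p₂) (hb1 : 0 ≤ b₁) (hb2 : 0 ≤ b₂)
    (hN : 0 ≤ N) (hM : (n:ℝ) < (M - N - 1 - (b₁ + b₂)) * q) :
    ∃ C : ℝ≥0∞, C ≠ ⊤ ∧ ∀ l j k : ℕ, k ≤ j → l ≤ j + 2 → ∀ (Cκ : ℝ≥0∞) (κ F G : Eu n → ℂ)
      (U V : Eu n → ℝ≥0∞), Cκ ≠ ⊤ → KB Cκ l M κ → Dom k N F U → Dom j N G V →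
      (∀ x, Integrable (fun y => κ (x - y) * G y)) →
      (∀ x, Integrable (fun y => κ (x - y) * (F y * G y))) →
      LN p (b₁ + b₂) (fun x => ‖(∫ y, κ (x - y) * (F y * G y)) - F x * ∫ y, κ (x - y) * G y‖ₑ) ≤
        C * Cκ * (tw (((j:ℝ) - l) * (n * (1 / q - 1))) * tw (-((l - k : ℕ) : ℝ))) *
          (LN p₁ b₁ U * LN p₂ b₂ V) := by
  have hq0 : 0 < ENNReal.ofReal q := by simpa using hq
  have hp : p ≠ 0 := (hq0.trans_le hqp).ne'
  have hp1' : p₁ ≠ 0 := (zero_lt_one.trans_le hp1).ne'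
  have hp2' : p₂ ≠ 0 := (zero_lt_one.trans_le hp2).ne'
  have hθ : 0 ≤ (n:ℝ) * (1 / q - 1) := by
    have : 1 ≤ 1 / q := by rw [le_div_iff₀ hq]; linarith
    have : 0 ≤ 1 / q - 1 := by linarith
    positivity
  have hb : 0 ≤ b₁ + b₂ := by positivity
  have hM' : (n:ℝ) < (M - (b₁ + b₂)) * q := by
    refine hM.trans_le ?_
    gcongr; linarith
  have hM2 : (n:ℝ) < M - b₂ := by
    have h0 : (0:ℝ) ≤ n := by positivity
    have h1 : 0 < M - (b₁ + b₂) := by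
      by_contra h
      have : (M - (b₁ + b₂)) * q ≤ 0 := mul_nonpos_of_nonpos_of_nonneg (by linarith) hq.le
      linarith
    have h2 : (M - (b₁ + b₂)) * q ≤ (M - (b₁ + b₂)) * 1 := by gcongr
    linarith
  obtain ⟨C1, hC1, H1⟩ := kp_peetre_LN (n := n) p q (b₁ + b₂) (N + N) (M - N - 1) hq hq1 hqp hb (by positivity) hM
  obtain ⟨C2, hC2, H2⟩ := kp_peetre_LN (n := n) p q (b₁ + b₂) (N + N) M hq hq1 hqp hb (by positivity) hM'
  set C3 : ℝ≥0∞ := (2:ℝ≥0∞) ^ (b₂ / 2) * cM n (M - b₂) with hC3d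
  have hC3 : C3 ≠ ⊤ := ENNReal.mul_ne_top (by simp) (cM_ne_top hM2)
  have h2q : (2:ℝ≥0∞) ^ (1 / q) ≠ ⊤ := by simp; 
  refine ⟨C1 + (2:ℝ≥0∞) ^ (1 / q) * (C2 + C3), ENNReal.add_ne_top.2 ⟨hC1, ENNReal.mul_ne_top h2q (ENNReal.add_ne_top.2 ⟨hC2, hC3⟩)⟩, ?_⟩
  intro l j k hkj hlj Cκ κ F G U V hCκ hκ hF hG hi1 hi2
  have hUV : Measurable (fun y => U y * V y) := hF.meas.mul hG.meas
  have hWs : ∀ y z, U y * V y ≤ dk j (-(N + N)) (y - z) * (U z * V z) := by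
    intro y z
    calc U y * V y ≤ (dk j (-N) (y - z) * U z) * (dk j (-N) (y - z) * V z) := by
          gcongr
          · refine (hF.slow y z).trans ?_
            gcongr
            exact dk_neg _ hN hkj
          · exact hG.slow y z
      _ = (dk j (-N) (y - z) * dk j (-N) (y - z)) * (U z * V z) := by ring
      _ = _ := by rw [dk_mul]; congr 2; ring
  have hH : LN p (b₁ + b₂) (fun x => U x * V x) ≤ LN p₁ b₁ U * LN p₂ b₂ V :=
    LN_holder p p₁ p₂ b₁ b₂ hp hp1' hp2' hexp hF.meas hG.meas
  set Z := LN p₁ b₁ U * LN p₂ b₂ V with hZ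
  by_cases hkl : k ≤ l
  · refine (LN_mono p _ (kp_comm_pt1 hCκ hkl hN hκ hF hG hi1 hi2)).trans ?_
    rw [LN_const_mul p hp _ _ (ENNReal.mul_ne_top hCκ (tw_ne_top _))]
    calc _ ≤ Cκ * tw (-((l - k : ℕ) : ℝ)) * (C1 * tw (((j:ℝ) - l) * (n * (1 / q - 1))) * Z) := by
          gcongr
          refine (H1 l j hlj _ hUV hWs).trans ?_
          gcongr
      _ = C1 * Cκ * (tw (((j:ℝ) - l) * (n * (1 / q - 1))) * tw (-((l - k : ℕ) : ℝ))) * Z := by ring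
      _ ≤ _ := by gcongr; exact le_self_add
  · have hlk : l - k = 0 := by omega
    have hlj' : (l:ℝ) ≤ j := by exact_mod_cast (by omega : l ≤ j)
    rw [hlk, Nat.cast_zero, neg_zero, tw_zero, mul_one]
    set E := tw (((j:ℝ) - l) * (n * (1 / q - 1))) with hE
    have hE1 : 1 ≤ E := one_le_tw (mul_nonneg (by linarith) hθ)
    refine (LN_mono p _ (kp_comm_pt2 hCκ hκ hF hG)).trans ?_
    have hcv := kp_measurable_conv (dk_measurable (n := n) l M) hG.meas
    have hcuv := kp_measurable_conv (dk_measurable (n := n) l M) hUV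
    have hfin := LN_add_le_of p (b₁ + b₂) q hq hq1 hqp
      (u := fun x => Cκ * (tw (l * n) * ∫⁻ y, dk l M (x - y) * (U y * V y)))
      (v := fun x => Cκ * (U x * (tw (l * n) * ∫⁻ y, dk l M (x - y) * V y)))
      ((hcuv.const_mul _).const_mul _)
      ((hF.meas.mul (hcv.const_mul _)).const_mul _)
      (Cκ * ((C2 + C3) * E * Z)) ?_ ?_
    · refine hfin.trans ?_
      calc _ = ((2:ℝ≥0∞) ^ (1 / q) * (C2 + C3)) * Cκ * E * Z := by ring
        _ ≤ _ := by gcongr; exact le_add_self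
    · rw [LN_const_mul p hp _ _ hCκ]
      gcongr
      refine (H2 l j hlj _ hUV hWs).trans ?_
      gcongr
      exact le_self_add
    · rw [LN_const_mul p hp _ _ hCκ]
      gcongr
      refine (LN_holder p p₁ p₂ b₁ b₂ hp hp1' hp2' hexp hF.meas (hcv.const_mul _)).trans ?_
      rw [LN_const_mul p₂ hp2' _ _ (tw_ne_top _)]
      have hY := LN_young p₂ hp2 b₂ hb2 M l hG.meas
      have e : tw (l * n) * ((2:ℝ≥0∞) ^ (b₂ / 2) * ((2:ℝ≥0∞) ^ (-(l * n : ℝ)) * cM n (M - b₂)) * LN p₂ b₂ V) =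
          C3 * LN p₂ b₂ V := by
        change tw (l * n) * (_ * (tw _ * _) * _) = _
        have : tw (l * n) * tw (-(l * n : ℝ)) = 1 := by rw [← tw_add]; simp [tw_zero]
        calc _ = (tw (l * n) * tw (-(l * n : ℝ))) * C3 * LN p₂ b₂ V := by rw [hC3d]; ring
          _ = _ := by rw [this, one_mul]
      calc _ ≤ LN p₁ b₁ U * (C3 * LN p₂ b₂ V) := by
            rw [← e]; gcongr
        _ = C3 * 1 * Z := by rw [hZ]; ring
        _ ≤ _ := by gcongr; exact le_add_self

end

section

/-! ### Kernels of the localized multipliers -/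
open FourierTransform
open scoped SchwartzMap ContDiff

def gsym2 (n : ℕ) (Φ : ℝ → ℝ) (z : ℝ × Eu n) : ℂ := ((Φ (z.1 ^ 2 + 4 * Real.pi ^ 2 * ‖z.2‖ ^ 2) : ℝ) : ℂ)
def gsym {n : ℕ} (Φ : ℝ → ℝ) (t : ℝ) (η : Eu n) : ℂ := gsym2 n Φ (t, η)
def br {n : ℕ} (η : Eu n) : ℝ := 1 + 4 * Real.pi ^ 2 * ‖η‖ ^ 2
def lsym {n : ℕ} (Φ : ℝ → ℝ) (l : ℕ) (η : Eu n) : ℂ := ((Φ (((4:ℝ) ^ l)⁻¹ * br η) : ℝ) : ℂ)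

lemma lsym_eq {n : ℕ} (Φ : ℝ → ℝ) (l : ℕ) (η : Eu n) :
    lsym Φ l η = gsym Φ ((2:ℝ) ^ l)⁻¹ (((2:ℝ) ^ l)⁻¹ • η) := by
  unfold lsym gsym gsym2 br
  congr 2
  rw [norm_smul, Real.norm_of_nonneg (by positivity)]
  have : (4:ℝ) ^ l = (2 ^ l) ^ 2 := by rw [← pow_mul, mul_comm, pow_mul]; norm_num
  rw [this]
  ring

lemma gsym2_contDiff (n : ℕ) {Φ : ℝ → ℝ} (h : ContDiff ℝ ∞ Φ) : ContDiff ℝ ∞ (gsym2 n Φ) := by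
  unfold gsym2
  apply Complex.ofRealCLM.contDiff.comp
  apply h.comp
  apply ContDiff.add
  · fun_prop
  · exact contDiff_const.mul (contDiff_snd.norm_sq ℝ)

lemma gsym2_compact (n : ℕ) {Φ : ℝ → ℝ} (hc : HasCompactSupport Φ) : HasCompactSupport (gsym2 n Φ) := by
  obtain ⟨R, hR⟩ := hc.isCompact.isBounded.subset_closedBall 0
  apply HasCompactSupport.intro (isCompact_closedBall (0 : ℝ × Eu n) (R + 1))
  intro z hz
  unfold gsym2
  have : Φ (z.1 ^ 2 + 4 * Real.pi ^ 2 * ‖z.2‖ ^ 2) = 0 := by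
    by_contra h
    have h1 := hR (subset_tsupport _ h)
    rw [mem_closedBall_zero_iff, Real.norm_of_nonneg (by positivity)] at h1
    apply hz
    have hpi : 1 ≤ 4 * Real.pi ^ 2 := by nlinarith [Real.pi_gt_three]
    have h2 : ‖z.2‖ ^ 2 ≤ 4 * Real.pi ^ 2 * ‖z.2‖ ^ 2 := by nlinarith [sq_nonneg ‖z.2‖]
    rw [mem_closedBall_zero_iff, Prod.norm_def, sup_le_iff]
    rw [Real.norm_eq_abs]
    have h3 : |z.1| ^ 2 = z.1 ^ 2 := sq_abs _
    constructor
    · nlinarith [sq_nonneg (|z.1| - 1), sq_nonneg ‖z.2‖, abs_nonneg z.1]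
    · nlinarith [sq_nonneg (‖z.2‖ - 1), sq_nonneg z.1, norm_nonneg z.2]
  simp [this]

def gS (n : ℕ) {Φ : ℝ → ℝ} (h : ContDiff ℝ ∞ Φ) (hc : HasCompactSupport Φ) : 𝓢(ℝ × Eu n, ℂ) :=
  (gsym2_compact n hc).toSchwartzMap (gsym2_contDiff n h)

lemma gsym_contDiff {n : ℕ} {Φ : ℝ → ℝ} (h : ContDiff ℝ ∞ Φ) (t : ℝ) : ContDiff ℝ ∞ (gsym (n := n) Φ t) :=
  (gsym2_contDiff n h).comp (by fun_prop : ContDiff ℝ ∞ (fun η : Eu n => (t, η)))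

lemma gsym_compact {n : ℕ} {Φ : ℝ → ℝ} (hc : HasCompactSupport Φ) (t : ℝ) :
    HasCompactSupport (gsym (n := n) Φ t) := by
  obtain ⟨K, hK, hK0⟩ := exists_compact_iff_hasCompactSupport.mpr (gsym2_compact n hc)
  apply HasCompactSupport.intro (hK.image continuous_snd)
  intro η hη
  apply hK0
  intro h
  exact hη ⟨_, h, rfl⟩

def gT {n : ℕ} {Φ : ℝ → ℝ} (h : ContDiff ℝ ∞ Φ) (hc : HasCompactSupport Φ) (t : ℝ) : 𝓢(Eu n, ℂ) :=
  (gsym_compact hc t).toSchwartzMap (gsym_contDiff h t)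

lemma gT_seminorm {n : ℕ} {Φ : ℝ → ℝ} (h : ContDiff ℝ ∞ Φ) (hc : HasCompactSupport Φ) (t : ℝ) (k m : ℕ) :
    SchwartzMap.seminorm ℝ k m (gT (n := n) h hc t) ≤ SchwartzMap.seminorm ℝ k m (gS n h hc) := by
  apply SchwartzMap.seminorm_le_bound _ _ _ _ (apply_nonneg _ _)
  intro η
  have e : (⇑(gT (n := n) h hc t)) = (fun z => gsym2 n Φ ((t, 0) + z)) ∘ (ContinuousLinearMap.inr ℝ ℝ (Eu n)) := by
    ext η
    simp [gT, gsym]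
  have hcd : ContDiff ℝ ∞ (fun z => gsym2 n Φ ((t, 0) + z)) :=
    (gsym2_contDiff n h).comp (by fun_prop)
  have e2 : (ContinuousLinearMap.inr ℝ ℝ (Eu n)) η = (0, η) := rfl
  rw [e, ContinuousLinearMap.iteratedFDeriv_comp_right _ hcd _ (by exact_mod_cast le_top), iteratedFDeriv_comp_add_left, e2]
  refine le_trans ?_ (SchwartzMap.le_seminorm ℝ k m (gS n h hc) (t, η))
  have e3 : ((t, 0) + (0, η) : ℝ × Eu n) = (t, η) := by simp
  rw [e3]
  gcongr
  · rw [Prod.norm_def]; exact le_max_right _ _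
  · refine (ContinuousMultilinearMap.norm_compContinuousLinearMap_le _ _).trans ?_
    change ‖iteratedFDeriv ℝ m (⇑(gS n h hc)) (t, η)‖ * _ ≤ _
    refine mul_le_of_le_one_right (norm_nonneg _) ?_
    apply Finset.prod_le_one
    · intros; positivity
    · intros; exact ContinuousLinearMap.norm_inr_le_one ℝ ℝ (Eu n)

def gI {n : ℕ} {Φ : ℝ → ℝ} (h : ContDiff ℝ ∞ Φ) (hc : HasCompactSupport Φ) (t : ℝ) : 𝓢(Eu n, ℂ) :=
  𝓕⁻ (gT (n := n) h hc t)

lemma kp_ker_unif {n : ℕ} {Φ : ℝ → ℝ} (h : ContDiff ℝ ∞ Φ) (hc : HasCompactSupport Φ) (K m : ℕ) :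
    ∃ C : ℝ, 0 < C ∧ ∀ t, ∀ x : Eu n, (1 + ‖x‖) ^ K * ‖iteratedFDeriv ℝ m (⇑(gI (n := n) h hc t)) x‖ ≤ C := by
  have hws := schwartz_withSeminorms ℝ (Eu n) ℂ
  have hb : Bornology.IsVonNBounded ℝ (Set.range (gT (n := n) h hc)) := by
    rw [hws.isVonNBounded_iff_seminorm_bounded]
    rintro ⟨k, m⟩
    refine ⟨SchwartzMap.seminorm ℝ k m (gS n h hc) + 1, by positivity, ?_⟩
    rintro _ ⟨t, rfl⟩
    exact (gT_seminorm h hc t k m).trans_lt (by linarith)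
  have hb2 := hb.image (FourierTransform.fourierInvCLM ℝ 𝓢(Eu n, ℂ))
  rw [hws.isVonNBounded_iff_finset_seminorm_bounded] at hb2
  obtain ⟨r, hr, H⟩ := hb2 (Finset.Iic (K, m))
  refine ⟨2 ^ K * r, by positivity, fun t x => ?_⟩
  have h1 := SchwartzMap.one_add_le_sup_seminorm_apply (𝕜 := ℝ) (m := (K, m)) le_rfl le_rfl (gI (n := n) h hc t) x
  refine h1.trans ?_
  gcongr
  exact (H _ ⟨gT h hc t, ⟨t, rfl⟩, rfl⟩).le

lemma lsym_contDiff {n : ℕ} {Φ : ℝ → ℝ} (h : ContDiff ℝ ∞ Φ) (l : ℕ) : ContDiff ℝ ∞ (lsym (n := n) Φ l) := by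
  have : lsym (n := n) Φ l = fun η => gsym Φ ((2:ℝ) ^ l)⁻¹ (((2:ℝ) ^ l)⁻¹ • η) := by ext; rw [lsym_eq]
  rw [this]
  exact (gsym_contDiff h _).comp (by fun_prop)

lemma lsym_compact {n : ℕ} {Φ : ℝ → ℝ} (hc : HasCompactSupport Φ) (l : ℕ) : HasCompactSupport (lsym (n := n) Φ l) := by
  have : lsym (n := n) Φ l = fun η => gsym Φ ((2:ℝ) ^ l)⁻¹ (((2:ℝ) ^ l)⁻¹ • η) := by ext; rw [lsym_eq]
  rw [this]
  exact (gsym_compact hc _).comp_smul (by positivity)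

def lT {n : ℕ} {Φ : ℝ → ℝ} (h : ContDiff ℝ ∞ Φ) (hc : HasCompactSupport Φ) (l : ℕ) : 𝓢(Eu n, ℂ) :=
  (lsym_compact hc l).toSchwartzMap (lsym_contDiff h l)

def lI {n : ℕ} {Φ : ℝ → ℝ} (h : ContDiff ℝ ∞ Φ) (hc : HasCompactSupport Φ) (l : ℕ) : 𝓢(Eu n, ℂ) :=
  𝓕⁻ (lT (n := n) h hc l)

lemma lT_inv {n : ℕ} {Φ : ℝ → ℝ} (h : ContDiff ℝ ∞ Φ) (hc : HasCompactSupport Φ) (l : ℕ) (x : Eu n) :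
    lI (n := n) h hc l x = ((2:ℝ) ^ l) ^ n • gI (n := n) h hc ((2:ℝ) ^ l)⁻¹ (((2:ℝ) ^ l) • x) := by
  unfold lI gI
  have h2 : ((2:ℝ) ^ l) ≠ 0 := by positivity
  rw [SchwartzMap.fourierInv_coe, SchwartzMap.fourierInv_coe, Real.fourierInv_eq', Real.fourierInv_eq']
  have := Measure.integral_comp_smul (volume : Measure (Eu n))
    (fun v => Complex.exp (↑(2 * Real.pi * ⟪v, ((2:ℝ) ^ l) • x⟫) * Complex.I) • (gT (n := n) h hc ((2:ℝ) ^ l)⁻¹) v) ((2:ℝ) ^ l)⁻¹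
  rw [finrank_euclideanSpace_fin, inv_pow, inv_inv, abs_of_pos (by positivity)] at this
  rw [← this]
  congr 1
  ext v
  congr 1
  · rw [inner_smul_left, inner_smul_right]
    simp [h2]
  · exact lsym_eq Φ l v

lemma kp_kernel {n : ℕ} {Φ : ℝ → ℝ} (h : ContDiff ℝ ∞ Φ) (hc : HasCompactSupport Φ) (K : ℕ) :
    ∃ C : ℝ≥0∞, C ≠ ⊤ ∧ ∀ l, KB C l K (lI (n := n) h hc l) ∧ KD C l K (lI (n := n) h hc l) := by
  obtain ⟨C0, hC0, H0⟩ := kp_ker_unif (n := n) h hc K 0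
  obtain ⟨C1, hC1, H1⟩ := kp_ker_unif (n := n) h hc K 1
  refine ⟨ENNReal.ofReal (C0 + C1), ENNReal.ofReal_ne_top, fun l => ?_⟩
  have etw : tw (l * n) = ENNReal.ofReal (((2:ℝ) ^ l) ^ n) := by
    rw [← pow_mul, ← tw_nat]; push_cast; rfl
  set t := ((2:ℝ) ^ l)⁻¹
  set G := gI (n := n) h hc t with hG
  have ns : ∀ x : Eu n, ‖((2:ℝ) ^ l) • x‖ = 2 ^ l * ‖x‖ := fun x => by
    rw [norm_smul, Real.norm_of_nonneg (by positivity)]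
  have b0 : ∀ x, ‖G x‖ ≤ C0 * (1 + ‖x‖) ^ (-(K:ℝ)) := by
    intro x
    have := H0 t x
    rw [norm_iteratedFDeriv_zero] at this
    rw [Real.rpow_neg (by positivity), Real.rpow_natCast, ← div_eq_mul_inv, le_div_iff₀ (by positivity), mul_comm]
    exact this
  have b1 : ∀ x, ‖fderiv ℝ G x‖ ≤ C1 * (1 + ‖x‖) ^ (-(K:ℝ)) := by
    intro x
    have := H1 t x
    rw [← norm_fderiv_iteratedFDeriv] at this
    have e : ‖fderiv ℝ (iteratedFDeriv ℝ 0 (⇑G)) x‖ = ‖fderiv ℝ G x‖ := by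
      rw [iteratedFDeriv_zero_eq_comp, LinearIsometryEquiv.comp_fderiv']
      exact LinearIsometry.norm_toContinuousLinearMap_comp _
    rw [e] at this
    rw [Real.rpow_neg (by positivity), Real.rpow_natCast, ← div_eq_mul_inv, le_div_iff₀ (by positivity), mul_comm]
    exact this
  have b2 : ∀ x y, ‖G x - G y‖ ≤ C1 * ((1 + ‖x - y‖) ^ (K:ℝ) * (1 + ‖y‖) ^ (-(K:ℝ))) * ‖x - y‖ := by
    intro x y
    apply (convex_segment y x).norm_image_sub_le_of_norm_fderiv_le (𝕜 := ℝ) (fun z _ => G.differentiableAt) _ (left_mem_segment ℝ y x) (right_mem_segment ℝ y x)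
    intro z hz
    refine (b1 z).trans ?_
    gcongr
    have hzy : ‖y - z‖ ≤ ‖x - y‖ := by
      obtain ⟨a, b, ha, hb, hab, rfl⟩ := hz
      have : y - (a • y + b • x) = b • (y - x) := by
        have : a = 1 - b := by linarith
        rw [this]; module
      rw [this, norm_smul, norm_sub_rev, Real.norm_of_nonneg hb]
      exact mul_le_of_le_one_left (norm_nonneg _) (by linarith)
    have h1 : 1 + ‖y‖ ≤ (1 + ‖x - y‖) * (1 + ‖z‖) := by
      have : ‖y‖ ≤ ‖y - z‖ + ‖z‖ := by
        have : y = (y - z) + z := by abel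
        conv_lhs => rw [this]
        exact norm_add_le _ _
      nlinarith [norm_nonneg z, norm_nonneg (x - y), mul_nonneg (norm_nonneg z) (norm_nonneg (x - y))]
    have p1 : 0 < 1 + ‖y‖ := by positivity
    have p2 : 0 < 1 + ‖z‖ := by positivity
    have p3 : 0 < 1 + ‖x - y‖ := by positivity
    rw [Real.rpow_neg p2.le, Real.rpow_neg p1.le, ← div_eq_mul_inv, inv_eq_one_div, div_le_div_iff₀ (by positivity) (by positivity), one_mul,
      ← Real.mul_rpow p3.le p2.le]
    exact Real.rpow_le_rpow p1.le h1 (by positivity)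
  constructor
  · intro x
    rw [lT_inv, etw]
    unfold dk
    rw [← ENNReal.ofReal_mul (by positivity), ← ENNReal.ofReal_mul (by positivity), ← ofReal_norm_eq_enorm]
    apply ENNReal.ofReal_le_ofReal
    rw [norm_smul, Real.norm_of_nonneg (by positivity)]
    have := b0 (((2:ℝ) ^ l) • x)
    rw [ns] at this
    calc _ ≤ ((2:ℝ) ^ l) ^ n * (C0 * (1 + 2 ^ l * ‖x‖) ^ (-(K:ℝ))) := by gcongr
      _ ≤ ((2:ℝ) ^ l) ^ n * ((C0 + C1) * (1 + 2 ^ l * ‖x‖) ^ (-(K:ℝ))) := by gcongr; linarith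
      _ = _ := by ring
  · intro x y
    rw [lT_inv, lT_inv, etw]
    unfold dk
    rw [← smul_sub, ← ENNReal.ofReal_mul (by positivity), ← ENNReal.ofReal_mul (by positivity), ← ENNReal.ofReal_mul (by positivity),
      ← ENNReal.ofReal_mul (by positivity), ← ofReal_norm_eq_enorm]
    apply ENNReal.ofReal_le_ofReal
    rw [norm_smul, Real.norm_of_nonneg (by positivity), neg_neg]
    have := b2 (((2:ℝ) ^ l) • x) (((2:ℝ) ^ l) • y)
    rw [← smul_sub, ns, ns] at this
    calc _ ≤ ((2:ℝ) ^ l) ^ n * (C1 * ((1 + 2 ^ l * ‖x - y‖) ^ (K:ℝ) * (1 + 2 ^ l * ‖y‖) ^ (-(K:ℝ))) * (2 ^ l * ‖x - y‖)) := by gcongr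
      _ ≤ ((2:ℝ) ^ l) ^ n * ((C0 + C1) * ((1 + 2 ^ l * ‖x - y‖) ^ (K:ℝ) * (1 + 2 ^ l * ‖y‖) ^ (-(K:ℝ))) * (2 ^ l * ‖x - y‖)) := by gcongr; linarith
      _ = _ := by ring

end

section
open FourierTransform
open scoped SchwartzMap ContDiff

/-! ### Fourier multipliers on Schwartz functions -/
def ft {n : ℕ} (f : 𝓢(Eu n, ℂ)) : 𝓢(Eu n, ℂ) := 𝓕 f
def fi {n : ℕ} (f : 𝓢(Eu n, ℂ)) : 𝓢(Eu n, ℂ) := 𝓕⁻ f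
def Tm {n : ℕ} (m : Eu n → ℂ) : 𝓢(Eu n, ℂ) →L[ℂ] 𝓢(Eu n, ℂ) := SchwartzMap.fourierMultiplierCLM ℂ m
def mulS {n : ℕ} (f g : 𝓢(Eu n, ℂ)) : 𝓢(Eu n, ℂ) := SchwartzMap.pairing (ContinuousLinearMap.mul ℂ ℂ) f g

lemma mulS_apply {n : ℕ} (f g : 𝓢(Eu n, ℂ)) (x) : mulS f g x = f x * g x := rfl
lemma fi_ft {n : ℕ} (f : 𝓢(Eu n, ℂ)) : fi (ft f) = f := by simp [fi, ft]
lemma ft_fi {n : ℕ} (f : 𝓢(Eu n, ℂ)) : ft (fi f) = f := by simp [fi, ft]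
lemma fi_apply {n : ℕ} (f : 𝓢(Eu n, ℂ)) (x : Eu n) : fi f x = ∫ η, Complex.exp (↑(2 * Real.pi * ⟪η, x⟫) * Complex.I) * f η := by
  unfold fi
  rw [SchwartzMap.fourierInv_coe, Real.fourierInv_eq']
  rfl
lemma ft_apply {n : ℕ} (f : 𝓢(Eu n, ℂ)) (x : Eu n) : ft f x = ∫ η, Complex.exp (↑(-2 * Real.pi * ⟪η, x⟫) * Complex.I) * f η := by
  unfold ft
  rw [SchwartzMap.fourier_coe, Real.fourier_eq']
  rfl
lemma fi_eq_ft_neg {n : ℕ} (f : 𝓢(Eu n, ℂ)) (x : Eu n) : fi f x = ft f (-x) := by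
  rw [fi_apply, ft_apply]
  congr 1; ext η; congr 3; simp
lemma ft_Tm {n : ℕ} {m : Eu n → ℂ} (hm : m.HasTemperateGrowth) (f : 𝓢(Eu n, ℂ)) (η : Eu n) : ft (Tm m f) η = m η * ft f η := by
  unfold Tm
  rw [SchwartzMap.fourierMultiplierCLM_apply]
  change ft (fi _) η = _
  rw [ft_fi, SchwartzMap.smulLeftCLM_apply_apply hm]
  rfl
lemma ft_ext {n : ℕ} {f g : 𝓢(Eu n, ℂ)} (h : ∀ η, ft f η = ft g η) : f = g := by
  have : ft f = ft g := by ext η; exact h η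
  rw [← fi_ft f, this, fi_ft]
lemma ft_smul {n : ℕ} (c : ℂ) (f : 𝓢(Eu n, ℂ)) : ft (c • f) = c • ft f := by
  simp [ft, FourierTransform.fourier_smul]
lemma ft_sum {n : ℕ} {ι : Type*} (t : Finset ι) (f : ι → 𝓢(Eu n, ℂ)) : ft (∑ i ∈ t, f i) = ∑ i ∈ t, ft (f i) := by
  exact map_sum (FourierTransform.fourierCLM ℂ 𝓢(Eu n, ℂ)) f t

lemma ft_conv {n : ℕ} (f g : 𝓢(Eu n, ℂ)) (x) : ft (SchwartzMap.convolution (ContinuousLinearMap.mul ℂ ℂ) f g) x = ft f x * ft g x := by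
  unfold ft
  rw [SchwartzMap.fourier_convolution]
  rfl

lemma fi_conv {n : ℕ} (f g : 𝓢(Eu n, ℂ)) (x) : fi (SchwartzMap.convolution (ContinuousLinearMap.mul ℂ ℂ) f g) x = fi f x * fi g x := by
  rw [fi_eq_ft_neg, fi_eq_ft_neg, fi_eq_ft_neg, ft_conv]

lemma ft_mul {n : ℕ} (f g : 𝓢(Eu n, ℂ)) (ζ : Eu n) : ft (mulS f g) ζ = ∫ ξ, ft f ξ * ft g (ζ - ξ) := by
  have : mulS f g = fi (SchwartzMap.convolution (ContinuousLinearMap.mul ℂ ℂ) (ft f) (ft g)) := by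
    ext x; rw [fi_conv, fi_ft, fi_ft]; rfl
  rw [this, ft_fi, SchwartzMap.convolution_apply]
  rfl

lemma Tm_conv {n : ℕ} (m f : 𝓢(Eu n, ℂ)) (x : Eu n) : Tm m f x = ∫ y, fi m (x - y) * f y := by
  have : Tm m f = SchwartzMap.convolution (ContinuousLinearMap.mul ℂ ℂ) f (fi m) := by
    apply ft_ext
    intro η
    rw [ft_Tm m.hasTemperateGrowth, ft_conv, ft_fi, mul_comm]
  rw [this, SchwartzMap.convolution_apply]
  change ∫ t, f t * fi m (x - t) = _
  congr 1; ext t; ring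

/-! ### Bessel potentials -/
def msym {n : ℕ} (s : ℝ) (η : Eu n) : ℂ := (((br η) ^ (s / 2) : ℝ) : ℂ)
lemma br_one {n : ℕ} (η : Eu n) : 1 ≤ br η := by
  unfold br
  have : 0 ≤ 4 * Real.pi ^ 2 * ‖η‖ ^ 2 := by positivity
  linarith
lemma br_pos {n : ℕ} (η : Eu n) : 0 < br η := lt_of_lt_of_le one_pos (br_one η)
lemma br_eq {n : ℕ} (η : Eu n) : br η = 1 + ‖(2 * Real.pi) • η‖ ^ 2 := by
  unfold br; rw [norm_smul, Real.norm_of_nonneg (by positivity)]; ring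

lemma msym_tg {n : ℕ} (s : ℝ) : (msym (n := n) s).HasTemperateGrowth := by
  have h := Function.hasTemperateGrowth_one_add_norm_sq_rpow (Eu n) (s / 2)
  have h2 := h.comp (f := fun η : Eu n => (2 * Real.pi) • η) (by fun_prop)
  have h3 := (Complex.ofRealCLM.hasTemperateGrowth).comp h2
  convert h3 using 1
  ext η
  simp [msym, br_eq]

def Jop {n : ℕ} (s : ℝ) : 𝓢(Eu n, ℂ) →L[ℂ] 𝓢(Eu n, ℂ) := Tm (msym s)

lemma ft_Jop {n : ℕ} (s : ℝ) (f : 𝓢(Eu n, ℂ)) (η : Eu n) : ft (Jop s f) η = msym s η * ft f η := ft_Tm (msym_tg s) f η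

lemma Js_eq {n : ℕ} (s : ℝ) (f : 𝓢(Eu n, ℂ)) (x : Eu n) : Js s f x = Jop s f x := by
  have h1 : ∀ η : Eu n, FT f ((2 * Real.pi) • η) = ft f η := by
    intro η
    rw [ft_apply]
    unfold FT
    congr 1; ext x
    rw [mul_comm]
    congr 2
    rw [inner_smul_right]; push_cast; ring
  rw [← fi_ft (Jop s f), fi_apply]
  unfold Js
  have := Measure.integral_comp_smul (volume : Measure (Eu n))
    (fun ξ => (((1 + ‖ξ‖ ^ 2) ^ (s / 2) : ℝ) : ℂ) * FT f ξ *
      Complex.exp (Complex.I * ((⟪x, ξ⟫ : ℝ) : ℂ))) (2 * Real.pi)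
  rw [finrank_euclideanSpace_fin, abs_of_pos (by positivity)] at this
  rw [← Complex.real_smul, ← this]
  congr 1; ext η
  rw [ft_Jop, h1, ← br_eq, inner_smul_right, real_inner_comm]
  unfold msym
  rw [mul_comm]
  congr 2
  push_cast; ring


lemma br_peetre {n : ℕ} (ξ ζ : Eu n) : br ζ ≤ 2 * br ξ * br (ζ - ξ) := by
  unfold br
  have h : ‖ζ‖ ≤ ‖ξ‖ + ‖ζ - ξ‖ := by
    have : ζ = ξ + (ζ - ξ) := by abel
    conv_lhs => rw [this]
    exact norm_add_le _ _
  have h2 : ‖ζ‖ ^ 2 ≤ 2 * (‖ξ‖ ^ 2 + ‖ζ - ξ‖ ^ 2) := by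
    nlinarith [sq_nonneg (‖ξ‖ - ‖ζ - ξ‖), norm_nonneg ζ]
  have h3 : 0 ≤ 4 * Real.pi ^ 2 := by positivity
  have h4 : 4 * Real.pi ^ 2 * ‖ζ‖ ^ 2 ≤ 4 * Real.pi ^ 2 * (2 * (‖ξ‖ ^ 2 + ‖ζ - ξ‖ ^ 2)) := by gcongr
  have h5 : 0 ≤ (4 * Real.pi ^ 2 * ‖ξ‖ ^ 2) * (4 * Real.pi ^ 2 * ‖ζ - ξ‖ ^ 2) := by positivity
  nlinarith

lemma msym_norm {n : ℕ} (s : ℝ) (η : Eu n) : ‖msym s η‖ = br η ^ (s / 2) := by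
  unfold msym
  rw [Complex.norm_real, Real.norm_of_nonneg (Real.rpow_nonneg (br_pos η).le _)]

lemma msym_peetre {n : ℕ} {s : ℝ} (hs : 0 ≤ s) (ξ ζ : Eu n) : ‖msym s ζ‖ ≤ 2 ^ (s / 2) * ‖msym s ξ‖ * ‖msym s (ζ - ξ)‖ := by
  have p1 := (br_pos ξ).le
  have p2 := (br_pos (ζ - ξ)).le
  rw [msym_norm, msym_norm, msym_norm, ← Real.mul_rpow (by norm_num) p1, ← Real.mul_rpow (by positivity) p2]
  exact Real.rpow_le_rpow (br_pos ζ).le (br_peetre ξ ζ) (by positivity)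

lemma Jop_prod_tendsto {n : ℕ} {s : ℝ} (hs : 0 ≤ s) (c : ℕ → Eu n → ℂ) (hc : ∀ N, (c N).HasTemperateGrowth)
    (hc1 : ∀ N η, ‖c N η‖ ≤ 1) (hlim : ∀ η, Filter.Tendsto (fun N => c N η) Filter.atTop (nhds 1))
    (f g : 𝓢(Eu n, ℂ)) (x : Eu n) :
    Filter.Tendsto (fun N => Jop s (mulS (Tm (c N) f) (Tm (c N) g)) x) Filter.atTop (nhds (Jop s (mulS f g) x)) := by
  have e : ∀ F G : 𝓢(Eu n, ℂ), Jop s (mulS F G) x = ∫ ζ, Complex.exp (↑(2 * Real.pi * ⟪ζ, x⟫) * Complex.I) * (msym s ζ * ∫ ξ, ft F ξ * ft G (ζ - ξ)) := by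
    intro F G
    rw [← fi_ft (Jop s (mulS F G)), fi_apply]
    simp_rw [ft_Jop, ft_mul]
  simp_rw [e]
  have hexp : ∀ ζ : Eu n, ‖Complex.exp (↑(2 * Real.pi * ⟪ζ, x⟫) * Complex.I)‖ = 1 := fun ζ => Complex.norm_exp_ofReal_mul_I _
  have hb : ∀ N (f : 𝓢(Eu n, ℂ)) ξ, ‖ft (Tm (c N) f) ξ‖ ≤ ‖ft f ξ‖ := by
    intro N f ξ
    rw [ft_Tm (hc N), norm_mul]
    exact mul_le_of_le_one_left (norm_nonneg _) (hc1 N ξ)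
  have hint : ∀ (F G : 𝓢(Eu n, ℂ)) (ζ : Eu n), Integrable (fun ξ => ‖ft F ξ‖ * ‖ft G (ζ - ξ)‖) := by
    intro F G ζ
    refine Integrable.mul_bdd (c := ‖(ft G).toBoundedContinuousFunction‖) (ft F).integrable.norm ?_ ?_
    · exact ((ft G).continuous.comp (by fun_prop)).norm.aestronglyMeasurable
    · refine Filter.Eventually.of_forall fun ξ => ?_
      rw [norm_norm]
      exact (ft G).toBoundedContinuousFunction.norm_coe_le_norm (ζ - ξ)
  have hbig : Integrable (fun ζ : Eu n => 2 ^ (s / 2) * ∫ ξ, ‖ft (Jop s f) ξ‖ * ‖ft (Jop s g) (ζ - ξ)‖) := by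
    refine Integrable.const_mul ?_ _
    exact (ft (Jop s f)).integrable.norm.integrable_convolution (ContinuousLinearMap.mul ℝ ℝ) (ft (Jop s g)).integrable.norm
  refine tendsto_integral_of_dominated_convergence _ ?_ hbig ?_ ?_
  · intro N
    have : (fun ζ : Eu n => Complex.exp (↑(2 * Real.pi * ⟪ζ, x⟫) * Complex.I) * (msym s ζ * ∫ ξ, ft (Tm (c N) f) ξ * ft (Tm (c N) g) (ζ - ξ)))
       = fun ζ => Complex.exp (↑(2 * Real.pi * ⟪ζ, x⟫) * Complex.I) * ft (Jop s (mulS (Tm (c N) f) (Tm (c N) g))) ζ := by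
      ext ζ; rw [ft_Jop, ft_mul]
    rw [this]
    apply Continuous.aestronglyMeasurable
    have := (ft (Jop s (mulS (Tm (c N) f) (Tm (c N) g)))).continuous
    fun_prop
  · intro N
    refine Filter.Eventually.of_forall fun ζ => ?_
    rw [norm_mul, hexp, one_mul, norm_mul]
    refine (mul_le_mul_of_nonneg_left (norm_integral_le_integral_norm _) (norm_nonneg _)).trans ?_
    rw [← integral_const_mul, ← integral_const_mul]
    apply integral_mono_of_nonneg
    · exact Filter.Eventually.of_forall fun ξ => by positivity
    · exact (hint (Jop s f) (Jop s g) ζ).const_mul _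
    · refine Filter.Eventually.of_forall fun ξ => ?_
      simp only [norm_mul]
      rw [ft_Jop, ft_Jop, norm_mul, norm_mul]
      calc _ ≤ (2 ^ (s / 2) * ‖msym s ξ‖ * ‖msym s (ζ - ξ)‖) * (‖ft f ξ‖ * ‖ft g (ζ - ξ)‖) := by
            gcongr
            · exact msym_peetre hs ξ ζ
            · exact hb _ _ _
            · exact hb _ _ _
        _ = _ := by ring
  · refine Filter.Eventually.of_forall fun ζ => ?_
    refine Filter.Tendsto.const_mul _ (Filter.Tendsto.const_mul _ ?_)
    refine tendsto_integral_of_dominated_convergence _ ?_ (hint f g ζ) ?_ ?_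
    · intro N
      exact ((ft (Tm (c N) f)).continuous.mul ((ft (Tm (c N) g)).continuous.comp (by fun_prop))).aestronglyMeasurable
    · intro N
      refine Filter.Eventually.of_forall fun ξ => ?_
      rw [norm_mul]
      gcongr
      · exact hb _ _ _
      · exact hb _ _ _
    · refine Filter.Eventually.of_forall fun ξ => ?_
      simp_rw [ft_Tm (hc _)]
      have h1 := (hlim ξ).mul_const (ft f ξ)
      have h2 := (hlim (ζ - ξ)).mul_const (ft g (ζ - ξ))
      simpa using h1.mul h2

end

section
open FourierTransform
open scoped SchwartzMap ContDiff

/-! ### Littlewood-Paley cutoffs -/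
def chi (r : ℝ) : ℝ := Real.smoothTransition (2 - r) * Real.smoothTransition (2 + r)
def phi (r : ℝ) : ℝ := chi r - chi (4 * r)

lemma chi_one {r : ℝ} (h : |r| ≤ 1) : chi r = 1 := by
  rw [abs_le] at h
  unfold chi
  rw [Real.smoothTransition.one_of_one_le (by linarith), Real.smoothTransition.one_of_one_le (by linarith), one_mul]
lemma chi_zero {r : ℝ} (h : 2 ≤ |r|) : chi r = 0 := by
  unfold chi
  rcases le_abs.mp h with h | h
  · rw [Real.smoothTransition.zero_of_nonpos (by linarith), zero_mul]
  · rw [Real.smoothTransition.zero_of_nonpos (x := 2 + r) (by linarith), mul_zero]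
lemma chi_nonneg (r : ℝ) : 0 ≤ chi r := mul_nonneg (Real.smoothTransition.nonneg _) (Real.smoothTransition.nonneg _)
lemma chi_le (r : ℝ) : chi r ≤ 1 := mul_le_one₀ (Real.smoothTransition.le_one _) (Real.smoothTransition.nonneg _) (Real.smoothTransition.le_one _)
lemma chi_smooth : ContDiff ℝ ∞ chi := by
  unfold chi
  exact (Real.smoothTransition.contDiff.comp (by fun_prop)).mul (Real.smoothTransition.contDiff.comp (by fun_prop))
lemma kp_cs {Φ : ℝ → ℝ} (h : ∀ r, 2 ≤ |r| → Φ r = 0) : HasCompactSupport Φ := by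
  apply HasCompactSupport.intro (isCompact_closedBall (0:ℝ) 2)
  intro r hr
  apply h
  rw [mem_closedBall_zero_iff, Real.norm_eq_abs] at hr
  exact (not_le.mp hr).le
lemma chi_compact : HasCompactSupport chi := kp_cs fun _ => chi_zero
lemma phi_smooth : ContDiff ℝ ∞ phi := chi_smooth.sub (chi_smooth.comp (by fun_prop))
lemma phi_zero {r : ℝ} (h : 2 ≤ |r|) : phi r = 0 := by
  unfold phi
  rw [chi_zero h, chi_zero, sub_zero]
  rw [abs_mul]; norm_num; linarith
lemma phi_zero' {r : ℝ} (h : |r| ≤ 1 / 4) : phi r = 0 := by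
  unfold phi
  rw [chi_one (by linarith), chi_one, sub_self]
  rw [abs_mul]; norm_num; linarith
lemma phi_compact : HasCompactSupport phi := kp_cs fun _ => phi_zero

def phip (α r : ℝ) : ℝ := phi r * r ^ α
lemma phip_smooth (α : ℝ) : ContDiff ℝ ∞ (phip α) := by
  rw [contDiff_iff_contDiffAt]
  intro r
  by_cases hr : r = 0
  · have : phip α =ᶠ[nhds r] fun _ => 0 := by
      subst hr
      have : Metric.ball (0:ℝ) (1/4) ∈ nhds (0:ℝ) := Metric.ball_mem_nhds _ (by norm_num)
      filter_upwards [this] with r hr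
      rw [mem_ball_zero_iff, Real.norm_eq_abs] at hr
      unfold phip
      rw [phi_zero' hr.le, zero_mul]
    exact contDiffAt_const.congr_of_eventuallyEq this
  · exact phi_smooth.contDiffAt.mul (Real.contDiffAt_rpow_const_of_ne hr)
lemma phip_compact (α : ℝ) : HasCompactSupport (phip α) := kp_cs fun r h => by unfold phip; rw [phi_zero h, zero_mul]

def chip (m : ℕ) (r : ℝ) : ℝ := chi r * r ^ m
lemma chip_smooth (m : ℕ) : ContDiff ℝ ∞ (chip m) := chi_smooth.mul (by fun_prop)
lemma chip_compact (m : ℕ) : HasCompactSupport (chip m) := kp_cs fun r h => by unfold chip; rw [chi_zero h, zero_mul]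

/-! ### Localized multipliers -/
def Pl {n : ℕ} (Φ : ℝ → ℝ) (l : ℕ) : 𝓢(Eu n, ℂ) →L[ℂ] 𝓢(Eu n, ℂ) := Tm (lsym Φ l)

lemma lsym_tg {n : ℕ} {Φ : ℝ → ℝ} (h : ContDiff ℝ ∞ Φ) (hc : HasCompactSupport Φ) (l : ℕ) :
    (lsym (n := n) Φ l).HasTemperateGrowth := (lsym_compact hc l).hasTemperateGrowth (lsym_contDiff h l)

lemma ft_Pl {n : ℕ} {Φ : ℝ → ℝ} (h : ContDiff ℝ ∞ Φ) (hc : HasCompactSupport Φ) (l : ℕ) (f : 𝓢(Eu n, ℂ)) (η : Eu n) :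
    ft (Pl Φ l f) η = lsym Φ l η * ft f η := ft_Tm (lsym_tg h hc l) f η

lemma Pl_conv {n : ℕ} {Φ : ℝ → ℝ} (h : ContDiff ℝ ∞ Φ) (hc : HasCompactSupport Φ) (l : ℕ) (f : 𝓢(Eu n, ℂ)) (x : Eu n) :
    Pl Φ l f x = ∫ y, lI h hc l (x - y) * f y := Tm_conv (lT h hc l) f x

lemma kp_four (l : ℕ) : (0:ℝ) < ((4:ℝ) ^ l)⁻¹ := by positivity

lemma kp_four_rpow (l : ℕ) (s : ℝ) : (((4:ℝ) ^ l)⁻¹) ^ (s / 2) = (2:ℝ) ^ (-(l * s)) := by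
  have : ((4:ℝ) ^ l)⁻¹ = (2:ℝ) ^ (-(2 * l : ℝ)) := by
    rw [Real.rpow_neg (by norm_num), Real.rpow_mul (by norm_num)]; norm_num
  rw [this, ← Real.rpow_mul (by norm_num)]
  congr 1; ring

lemma Jop_Pl {n : ℕ} (s : ℝ) {Φ Ψ : ℝ → ℝ} (h : ContDiff ℝ ∞ Φ) (hc : HasCompactSupport Φ) (h' : ContDiff ℝ ∞ Ψ) (hc' : HasCompactSupport Ψ)
    (e : ∀ r, 0 < r → Ψ r = Φ r * r ^ (s / 2)) (l : ℕ) (f : 𝓢(Eu n, ℂ)) :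
    Jop s (Pl Φ l f) = (((2:ℝ) ^ (l * s) : ℝ) : ℂ) • Pl Ψ l f := by
  apply ft_ext
  intro η
  rw [ft_Jop, ft_Pl h hc, ft_smul, SchwartzMap.smul_apply, ft_Pl h' hc', smul_eq_mul, ← mul_assoc, ← mul_assoc]
  congr 1
  unfold msym lsym
  have hb := br_pos η
  rw [e _ (mul_pos (kp_four l) hb), Real.mul_rpow (kp_four l).le hb.le, kp_four_rpow, Real.rpow_neg (by norm_num)]
  have : (2:ℝ) ^ (l * s) ≠ 0 := by positivity
  norm_cast
  field_simp

lemma Pl_Jop {n : ℕ} (s : ℝ) {Φ Ψ : ℝ → ℝ} (h : ContDiff ℝ ∞ Φ) (hc : HasCompactSupport Φ) (h' : ContDiff ℝ ∞ Ψ) (hc' : HasCompactSupport Ψ)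
    (e : ∀ r, 0 < r → Ψ r = Φ r * r ^ (-s / 2)) (l : ℕ) (f : 𝓢(Eu n, ℂ)) :
    Pl Φ l f = (((2:ℝ) ^ (-(l * s)) : ℝ) : ℂ) • Pl Ψ l (Jop s f) := by
  apply ft_ext
  intro η
  rw [ft_Pl h hc, ft_smul, SchwartzMap.smul_apply, ft_Pl h' hc', ft_Jop, smul_eq_mul, ← mul_assoc, ← mul_assoc]
  congr 1
  unfold msym lsym
  have hb := br_pos η
  rw [e _ (mul_pos (kp_four l) hb), Real.mul_rpow (kp_four l).le hb.le, kp_four_rpow, Real.rpow_neg (by norm_num), neg_div, Real.rpow_neg hb.le,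
    mul_neg, neg_neg]
  have h1 : (2:ℝ) ^ (l * s) ≠ 0 := by positivity
  have h2 : br η ^ (s / 2) ≠ 0 := by positivity
  norm_cast
  field_simp

lemma Pl_comm {n : ℕ} (s : ℝ) {Φ : ℝ → ℝ} (h : ContDiff ℝ ∞ Φ) (hc : HasCompactSupport Φ) (l : ℕ) (f : 𝓢(Eu n, ℂ)) :
    Jop s (Pl Φ l f) = Pl Φ l (Jop s f) := by
  apply ft_ext
  intro η
  rw [ft_Jop, ft_Pl h hc, ft_Pl h hc, ft_Jop]
  ring

lemma chi_telescope {n : ℕ} (N : ℕ) (η : Eu n) : lsym chi N η = ∑ l ∈ Finset.range (N + 1), lsym phi l η := by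
  induction N with
  | zero =>
    simp only [zero_add, Finset.sum_range_one, lsym, phi, pow_zero, inv_one, one_mul]
    rw [chi_zero (r := 4 * br η), sub_zero]
    have := br_one η
    rw [abs_of_nonneg (by linarith)]; linarith
  | succ N ih =>
    rw [Finset.sum_range_succ, ← ih]
    unfold lsym phi
    have : 4 * (((4:ℝ) ^ (N + 1))⁻¹ * br η) = ((4:ℝ) ^ N)⁻¹ * br η := by
      rw [pow_succ, mul_inv]; ring
    rw [this]
    push_cast; ring

lemma Pl_chi_sum {n : ℕ} (N : ℕ) (f : 𝓢(Eu n, ℂ)) : Pl chi N f = ∑ l ∈ Finset.range (N + 1), Pl phi l f := by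
  apply ft_ext
  intro η
  rw [ft_Pl chi_smooth chi_compact, ft_sum, SchwartzMap.sum_apply, chi_telescope, Finset.sum_mul]
  apply Finset.sum_congr rfl
  intro l _
  rw [ft_Pl phi_smooth phi_compact]

lemma Pl_chi_id {n : ℕ} (L : ℕ) (H : 𝓢(Eu n, ℂ)) (h : ∀ η, ft H η ≠ 0 → br η ≤ 4 ^ L) : Pl chi L H = H := by
  apply ft_ext
  intro η
  rw [ft_Pl chi_smooth chi_compact]
  by_cases h0 : ft H η = 0
  · rw [h0, mul_zero]
  · unfold lsym
    rw [chi_one, Complex.ofReal_one, one_mul]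
    rw [abs_of_pos (mul_pos (kp_four L) (br_pos η)), inv_mul_le_iff₀ (by positivity), mul_one]
    exact h η h0

lemma Pl_phi_supp {n : ℕ} (k : ℕ) (f : 𝓢(Eu n, ℂ)) (η : Eu n) (h : ft (Pl phi k f) η ≠ 0) : br η ≤ 2 * 4 ^ k := by
  rw [ft_Pl phi_smooth phi_compact] at h
  by_contra h2
  apply h
  unfold lsym
  rw [phi_zero, Complex.ofReal_zero, zero_mul]
  rw [abs_of_pos (mul_pos (kp_four k) (br_pos η)), inv_mul_eq_div, le_div_iff₀ (by positivity)]
  exact (not_le.mp h2).le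

lemma Pl_chi_G {n : ℕ} (j : ℕ) (g : 𝓢(Eu n, ℂ)) : Pl chi (j + 2) (Pl phi j g) = Pl phi j g := by
  apply Pl_chi_id
  intro η h
  have := Pl_phi_supp j g η h
  have h4 : (0:ℝ) < 4 ^ j := by positivity
  rw [pow_add]; linarith

lemma Pl_chi_FG {n : ℕ} {j k : ℕ} (hkj : k ≤ j) (f g : 𝓢(Eu n, ℂ)) :
    Pl chi (j + 2) (mulS (Pl phi k f) (Pl phi j g)) = mulS (Pl phi k f) (Pl phi j g) := by
  apply Pl_chi_id
  intro ζ h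
  rw [ft_mul] at h
  by_contra hb
  apply h
  rw [← integral_zero (Eu n) ℂ]
  congr 1; ext ξ
  by_contra h0
  have h1 := Pl_phi_supp k f ξ (left_ne_zero_of_mul h0)
  have h2 := Pl_phi_supp j g (ζ - ξ) (right_ne_zero_of_mul h0)
  apply hb
  have h3 : (4:ℝ) ^ k ≤ 4 ^ j := pow_le_pow_right₀ (by norm_num) hkj
  have h4 : br ζ ≤ 2 * br ξ + 2 * br (ζ - ξ) := by
    unfold br
    have h : ‖ζ‖ ≤ ‖ξ‖ + ‖ζ - ξ‖ := by
      have : ζ = ξ + (ζ - ξ) := by abel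
      conv_lhs => rw [this]
      exact norm_add_le _ _
    have h2 : ‖ζ‖ ^ 2 ≤ 2 * (‖ξ‖ ^ 2 + ‖ζ - ξ‖ ^ 2) := by
      nlinarith [sq_nonneg (‖ξ‖ - ‖ζ - ξ‖), norm_nonneg ζ]
    have h4 : 4 * Real.pi ^ 2 * ‖ζ‖ ^ 2 ≤ 4 * Real.pi ^ 2 * (2 * (‖ξ‖ ^ 2 + ‖ζ - ξ‖ ^ 2)) := by gcongr
    nlinarith
  rw [pow_add]
  linarith [pow_pos (by norm_num : (0:ℝ) < 4) j]

end

section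
open FourierTransform
open scoped SchwartzMap ContDiff

def sn {n : ℕ} (p : ℝ≥0∞) (b : ℝ) (f : 𝓢(Eu n, ℂ)) : ℝ≥0∞ := LN p b (fun x => ‖f x‖ₑ)

lemma S_meas {n : ℕ} (f : 𝓢(Eu n, ℂ)) : Measurable f := f.continuous.measurable
lemma S_emeas {n : ℕ} (f : 𝓢(Eu n, ℂ)) : Measurable (fun x => ‖f x‖ₑ) := (S_meas f).enorm

lemma S_int {n : ℕ} (κ f : 𝓢(Eu n, ℂ)) (x : Eu n) : Integrable (fun y => κ (x - y) * f y) := by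
  refine Integrable.bdd_mul (c := ‖κ.toBoundedContinuousFunction‖) f.integrable ?_ ?_
  · exact (κ.continuous.comp (by fun_prop)).aestronglyMeasurable
  · exact Filter.Eventually.of_forall fun y => κ.toBoundedContinuousFunction.norm_coe_le_norm (x - y)

lemma KB.mono {n : ℕ} {C C' : ℝ≥0∞} (h : C ≤ C') {l : ℕ} {K : ℝ} {κ : Eu n → ℂ} (H : KB C l K κ) : KB C' l K κ :=
  fun x => (H x).trans (by gcongr)
lemma KD.mono {n : ℕ} {C C' : ℝ≥0∞} (h : C ≤ C') {l : ℕ} {K : ℝ} {κ : Eu n → ℂ} (H : KD C l K κ) : KD C' l K κ :=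
  fun x y => (H x y).trans (by gcongr)

lemma kp_enorm_tw (x : ℝ) (z : ℂ) : ‖(((2:ℝ) ^ x : ℝ) : ℂ) • z‖ₑ = tw x * ‖z‖ₑ := by
  rw [enorm_smul, tw_ofReal]
  congr 1
  rw [← ofReal_norm, Complex.norm_real, Real.norm_of_nonneg (by positivity)]

lemma LN_young' {n : ℕ} (r : ℝ≥0∞) (hr : 1 ≤ r) (b : ℝ) (hb : 0 ≤ b) (M : ℝ) (l : ℕ) (c C : ℝ≥0∞) (hc : c ≠ ⊤) (hC : C ≠ ⊤)
    {u : Eu n → ℝ≥0∞} (hu : Measurable u) :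
    LN r b (fun x => c * (C * tw (l * n)) * ∫⁻ y, dk l M (x - y) * u y) ≤
      (C * ((2:ℝ≥0∞) ^ (b / 2) * cM n (M - b))) * (c * LN r b u) := by
  have hr0 : r ≠ 0 := (zero_lt_one.trans_le hr).ne'
  rw [LN_const_mul r hr0 b _ (ENNReal.mul_ne_top hc (ENNReal.mul_ne_top hC (tw_ne_top _)))]
  refine (mul_le_mul_right (LN_young r hr b hb M l hu) _).trans ?_
  have e : tw (l * n) * (2:ℝ≥0∞) ^ (-(l * n : ℝ)) = 1 := by
    change tw _ * tw _ = 1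
    rw [← tw_add, add_neg_cancel, tw_zero]
  calc _ = (tw (l * n) * (2:ℝ≥0∞) ^ (-(l * n : ℝ))) * ((C * ((2:ℝ≥0∞) ^ (b / 2) * cM n (M - b))) * (c * LN r b u)) := by ring
    _ ≤ _ := by rw [e, one_mul]

lemma Pl_LN {n : ℕ} (p : ℝ≥0∞) (hp : 1 ≤ p) (b : ℝ) (hb : 0 ≤ b) {Φ : ℝ → ℝ} (h : ContDiff ℝ ∞ Φ) (hc : HasCompactSupport Φ) :
    ∃ C : ℝ≥0∞, C ≠ ⊤ ∧ ∀ (l : ℕ) (f : 𝓢(Eu n, ℂ)), sn p b (Pl Φ l f) ≤ C * sn p b f := by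
  obtain ⟨N, hN⟩ := exists_nat_gt (n + b)
  obtain ⟨C, hC, H⟩ := kp_kernel (n := n) h hc N
  refine ⟨C * ((2:ℝ≥0∞) ^ (b / 2) * cM n (N - b)), ENNReal.mul_ne_top hC (ENNReal.mul_ne_top (tw_ne_top _) (cM_ne_top (by linarith))), fun l f => ?_⟩
  have := LN_young' p hp b hb N l 1 C (by simp) hC (S_emeas f)
  rw [one_mul (LN _ _ _)] at this
  refine le_trans (LN_mono _ _ fun x => ?_) this
  rw [Pl_conv h hc, one_mul]
  exact kp_conv_le hC (H l).1 x

lemma kp_piece {n : ℕ} (p : ℝ≥0∞) (hp : 1 ≤ p) (b : ℝ) (hb : 0 ≤ b) (s : ℝ) (N : ℕ) (hN : n + b < N) :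
    ∃ C : ℝ≥0∞, C ≠ ⊤ ∧ ∀ (k : ℕ) (f : 𝓢(Eu n, ℂ)), ∃ U : Eu n → ℝ≥0∞, Dom k N (Pl phi k f) U ∧
      (∀ x, ‖Jop s (Pl phi k f) x‖ₑ ≤ tw (k * s) * U x) ∧
      LN p b U ≤ C * min (sn p b f) (tw (-(k * s)) * sn p b (Jop s f)) := by
  obtain ⟨C1, hC1, H1⟩ := kp_kernel (n := n) phi_smooth phi_compact N
  obtain ⟨C2, hC2, H2⟩ := kp_kernel (n := n) (phip_smooth (s / 2)) (phip_compact (s / 2)) N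
  obtain ⟨C3, hC3, H3⟩ := kp_kernel (n := n) (phip_smooth (-s / 2)) (phip_compact (-s / 2)) N
  set C := C1 + C2 + C3 with hCd
  have hC : C ≠ ⊤ := by simp [hCd, hC1, hC2, hC3]
  have l1 : C1 ≤ C := by rw [hCd, add_assoc]; exact le_self_add
  have l2 : C2 ≤ C := by rw [hCd, add_comm C1, add_assoc]; exact le_self_add
  have l3 : C3 ≤ C := by rw [hCd]; exact le_add_self
  refine ⟨C * ((2:ℝ≥0∞) ^ (b / 2) * cM n (N - b)), ENNReal.mul_ne_top hC (ENNReal.mul_ne_top (tw_ne_top _) (cM_ne_top (by linarith))), fun k f => ?_⟩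
  have hcan : tw (k * s) * tw (-(k * s)) = 1 := by rw [← tw_add, add_neg_cancel, tw_zero]
  rcases le_total (sn p b f) (tw (-(k * s)) * sn p b (Jop s f)) with hle | hle
  · refine ⟨fun x => 1 * (C * tw (k * n)) * ∫⁻ y, dk k N (x - y) * ‖f y‖ₑ, ?_, ?_, ?_⟩
    · apply kp_conv_dom (Nat.cast_nonneg N) hC (by simp) ((H1 k).1.mono l1) ((H1 k).2.mono l1) (S_meas f) (S_int _ f)
      · intro x x'; rw [Pl_conv phi_smooth phi_compact, Pl_conv phi_smooth phi_compact, one_mul]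
      · intro x; rw [Pl_conv phi_smooth phi_compact, one_mul]
    · intro x
      rw [Jop_Pl s phi_smooth phi_compact (phip_smooth (s/2)) (phip_compact (s/2)) (fun r _ => rfl), smul_apply, kp_enorm_tw,
        Pl_conv (phip_smooth (s/2)) (phip_compact (s/2)), one_mul]
      gcongr
      exact kp_conv_le hC ((H2 k).1.mono l2) x
    · rw [min_eq_left hle]
      have := LN_young' p hp b hb N k 1 C (by simp) hC (S_emeas f)
      rwa [one_mul (LN _ _ _)] at this
  · refine ⟨fun x => tw (-(k * s)) * (C * tw (k * n)) * ∫⁻ y, dk k N (x - y) * ‖Jop s f y‖ₑ, ?_, ?_, ?_⟩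
    · have e := Pl_Jop s phi_smooth phi_compact (phip_smooth (-s/2)) (phip_compact (-s/2)) (fun r _ => rfl) k f
      apply kp_conv_dom (Nat.cast_nonneg N) hC (tw_ne_top _) ((H3 k).1.mono l3) ((H3 k).2.mono l3) (S_meas (Jop s f)) (S_int _ (Jop s f))
      · intro x x'
        rw [e, smul_apply, smul_apply, ← smul_sub, kp_enorm_tw, Pl_conv (phip_smooth (-s/2)) (phip_compact (-s/2)), Pl_conv (phip_smooth (-s/2)) (phip_compact (-s/2))]
      · intro x
        rw [e, smul_apply, kp_enorm_tw, Pl_conv (phip_smooth (-s/2)) (phip_compact (-s/2))]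
    · intro x
      rw [Pl_comm s phi_smooth phi_compact, Pl_conv phi_smooth phi_compact, ← mul_assoc, ← mul_assoc, hcan, one_mul]
      exact kp_conv_le hC ((H1 k).1.mono l1) x
    · rw [min_eq_right hle]
      exact LN_young' p hp b hb N k _ C (tw_ne_top _) hC (S_emeas (Jop s f))

end

section
open FourierTransform
open scoped SchwartzMap ContDiff

def commP {n : ℕ} (Φ : ℝ → ℝ) (l : ℕ) (F G : 𝓢(Eu n, ℂ)) (x : Eu n) : ℂ := Pl Φ l (mulS F G) x - F x * Pl Φ l G x

lemma commP_meas {n : ℕ} (Φ : ℝ → ℝ) (l : ℕ) (F G : 𝓢(Eu n, ℂ)) : Measurable (fun x => ‖commP Φ l F G x‖ₑ) := by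
  unfold commP
  exact ((S_meas _).sub ((S_meas F).mul (S_meas _))).enorm

lemma kp_comm_Pl {n : ℕ} (p p₁ p₂ : ℝ≥0∞) (b₁ b₂ q N : ℝ) (hq : 0 < q) (hq1 : q ≤ 1)
    (hqp : ENNReal.ofReal q ≤ p) (hp1 : 1 ≤ p₁) (hp2 : 1 ≤ p₂)
    (hexp : 1 / p = 1 / p₁ + 1 / p₂) (hb1 : 0 ≤ b₁) (hb2 : 0 ≤ b₂)
    (hN : 0 ≤ N) {Φ : ℝ → ℝ} (h : ContDiff ℝ ∞ Φ) (hc : HasCompactSupport Φ) :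
    ∃ C : ℝ≥0∞, C ≠ ⊤ ∧ ∀ l j k : ℕ, k ≤ j → l ≤ j + 2 → ∀ (F G : 𝓢(Eu n, ℂ))
      (U V : Eu n → ℝ≥0∞), Dom k N F U → Dom j N G V →
      LN p (b₁ + b₂) (fun x => ‖commP Φ l F G x‖ₑ) ≤
        C * (tw (((j:ℝ) - l) * (n * (1 / q - 1))) * tw (-((l - k : ℕ) : ℝ))) *
          (LN p₁ b₁ U * LN p₂ b₂ V) := by
  obtain ⟨M, hM⟩ := exists_nat_gt (n / q + N + 1 + (b₁ + b₂))
  have hM' : (n:ℝ) < ((M:ℝ) - N - 1 - (b₁ + b₂)) * q := by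
    rw [← div_lt_iff₀ hq]; linarith
  obtain ⟨C, hC, H⟩ := kp_comm_LN (n := n) p p₁ p₂ b₁ b₂ q N M hq hq1 hqp hp1 hp2 hexp hb1 hb2 hN hM'
  obtain ⟨C1, hC1, H1⟩ := kp_kernel (n := n) h hc M
  refine ⟨C * C1, ENNReal.mul_ne_top hC hC1, fun l j k hkj hlj F G U V hF hG => ?_⟩
  have := H l j k hkj hlj C1 (lI h hc l) F G U V hC1 (H1 l).1 hF hG (S_int _ G) (S_int _ (mulS F G))
  refine le_trans (le_of_eq ?_) this
  congr 1; ext x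
  unfold commP
  rw [Pl_conv h hc, Pl_conv h hc]
  rfl

lemma kp_geo_tw (e : ℝ) (he : 0 < e) : ∃ C : ℝ≥0∞, C ≠ ⊤ ∧ ∀ J : ℕ, ∑ l ∈ Finset.range (J + 1), tw (-(e * ((J:ℝ) - l))) ≤ C := by
  refine ⟨∑' i : ℕ, tw (-e) ^ i, ?_, fun J => ?_⟩
  · rw [ENNReal.tsum_geometric, ENNReal.inv_ne_top, Ne, tsub_eq_zero_iff_le, not_le]
    rw [← tw_zero]
    exact ENNReal.rpow_lt_rpow_of_exponent_lt (by norm_num) (by simp) (by linarith)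
  · rw [← Finset.sum_range_reflect]
    refine le_trans (Finset.sum_le_sum (g := fun i => tw (-e) ^ i) ?_) (ENNReal.sum_le_tsum _)
    intro i hi
    rw [Finset.mem_range] at hi
    rw [← ENNReal.rpow_natCast, tw_rpow]
    apply tw_mono
    have : ((J + 1 - 1 - i : ℕ) : ℝ) = J - i := by
      rw [Nat.add_sub_cancel, Nat.cast_sub (by omega)]
    rw [this]; linarith

lemma kp_expo {s σ δ : ℝ} (h1 : 2 * δ ≤ s - σ) (h2 : 2 * δ ≤ 1) (hδ : 0 < δ) (j k l : ℕ) (hkj : k ≤ j) (hl : l ≤ j + 2) :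
    (l:ℝ) * s + (((j:ℝ) - l) * σ + -((l - k : ℕ) : ℝ)) ≤ (j * s + -(δ * ((j:ℝ) - k))) + (-(δ * ((j + 2 : ℕ) - (l:ℝ))) + (2 * (s - σ) + 4 * δ)) := by
  have hkj' : (k:ℝ) ≤ j := by exact_mod_cast hkj
  have hl' : (l:ℝ) ≤ j + 2 := by exact_mod_cast hl
  have e : (l:ℝ) * s + ((j:ℝ) - l) * σ = j * s - ((j:ℝ) - l) * (s - σ) := by ring
  set E := s - σ
  push_cast
  have hsub : (l:ℝ) - k ≤ ((l - k : ℕ) : ℝ) := by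
    rcases le_total k l with h | h
    · rw [Nat.cast_sub h]
    · have : (l:ℝ) ≤ k := by exact_mod_cast h
      have h0 : (0:ℝ) ≤ ((l - k : ℕ) : ℝ) := by positivity
      linarith
  have h0 : (0:ℝ) ≤ ((l - k : ℕ) : ℝ) := by positivity
  have h3 : δ * ((l:ℝ) - k) ≤ ((l - k : ℕ) : ℝ) := by
    have : δ * ((l:ℝ) - k) ≤ δ * ((l - k : ℕ) : ℝ) := by gcongr
    nlinarith
  rcases le_total l j with h | h
  · have hlj : (l:ℝ) ≤ j := by exact_mod_cast h
    have : (2 * δ) * ((j:ℝ) - l) ≤ ((j:ℝ) - l) * E := by nlinarith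
    nlinarith
  · have hlj : (j:ℝ) ≤ l := by exact_mod_cast h
    have : ((l:ℝ) - j) * E ≤ 2 * E := by nlinarith
    nlinarith

lemma kp_rem1 {n : ℕ} (p p₁ p₂ : ℝ≥0∞) (b₁ b₂ q N s : ℝ) (hq : 0 < q) (hq1 : q ≤ 1)
    (hqp : ENNReal.ofReal q ≤ p) (hp1 : 1 ≤ p₁) (hp2 : 1 ≤ p₂)
    (hexp : 1 / p = 1 / p₁ + 1 / p₂) (hb1 : 0 ≤ b₁) (hb2 : 0 ≤ b₂) (hN : 0 ≤ N) (hs0 : 0 < s)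
    (hs : n * (1 / q - 1) < s) :
    ∃ δ : ℝ, 0 < δ ∧ δ ≤ s ∧ ∃ C : ℝ≥0∞, C ≠ ⊤ ∧ ∀ j k : ℕ, k ≤ j → ∀ (f g : 𝓢(Eu n, ℂ))
      (U V : Eu n → ℝ≥0∞), Dom k N (Pl phi k f) U → Dom j N (Pl phi j g) V →
      LN p (b₁ + b₂) (fun x => ‖Jop s (mulS (Pl phi k f) (Pl phi j g)) x - Pl phi k f x * Jop s (Pl phi j g) x‖ₑ) ^ q ≤
        C * (tw (j * s + -(δ * ((j:ℝ) - k))) * (LN p₁ b₁ U * LN p₂ b₂ V)) ^ q := by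
  have hq0 : 0 < ENNReal.ofReal q := by simpa using hq
  have hp : p ≠ 0 := (hq0.trans_le hqp).ne'
  set σ := (n:ℝ) * (1 / q - 1) with hσ
  have hσ0 : 0 ≤ σ := by
    have : 1 ≤ 1 / q := by rw [le_div_iff₀ hq]; linarith
    have : 0 ≤ 1 / q - 1 := by linarith
    positivity
  set δ := min (s - σ) 1 / 2 with hδ
  have hδ0 : 0 < δ := by
    have : 0 < min (s - σ) 1 := lt_min (by linarith) one_pos
    positivity
  have hδ1 : 2 * δ ≤ s - σ := by have := min_le_left (s - σ) 1; linarith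
  have hδ2 : 2 * δ ≤ 1 := by have := min_le_right (s - σ) 1; linarith
  obtain ⟨C, hC, H⟩ := kp_comm_Pl (n := n) p p₁ p₂ b₁ b₂ q N hq hq1 hqp hp1 hp2 hexp hb1 hb2 hN (phip_smooth (s/2)) (phip_compact (s/2))
  obtain ⟨D, hD, HD⟩ := kp_geo_tw (δ * q) (by positivity)
  refine ⟨δ, hδ0, by linarith, (C * tw (2 * (s - σ) + 4 * δ)) ^ q * D, ENNReal.mul_ne_top (ENNReal.rpow_ne_top_of_nonneg hq.le (ENNReal.mul_ne_top hC (tw_ne_top _))) hD,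
    fun j k hkj f g U V hF hG => ?_⟩
  set F := Pl phi k f
  set G := Pl phi j g with hGd
  have hJ : ∀ H : 𝓢(Eu n, ℂ), Pl chi (j + 2) H = H → ∀ x, Jop s H x = ∑ l ∈ Finset.range (j + 2 + 1), (((2:ℝ) ^ (l * s) : ℝ) : ℂ) • Pl (phip (s/2)) l H x := by
    intro H hH x
    conv_lhs => rw [← hH]
    rw [Pl_chi_sum, map_sum, sum_apply]
    apply Finset.sum_congr rfl
    intro l _
    rw [Jop_Pl s phi_smooth phi_compact (phip_smooth (s/2)) (phip_compact (s/2)) (fun r _ => rfl), smul_apply]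
  have e : ∀ x, Jop s (mulS F G) x - F x * Jop s G x = ∑ l ∈ Finset.range (j + 2 + 1), (((2:ℝ) ^ (l * s) : ℝ) : ℂ) • commP (phip (s/2)) l F G x := by
    intro x
    rw [hJ _ (Pl_chi_FG hkj f g), hJ _ (Pl_chi_G j g), Finset.mul_sum, ← Finset.sum_sub_distrib]
    apply Finset.sum_congr rfl
    intro l _
    unfold commP
    simp only [smul_eq_mul]; ring
  have h1 : LN p (b₁ + b₂) (fun x => ‖Jop s (mulS F G) x - F x * Jop s G x‖ₑ) ≤
      LN p (b₁ + b₂) (fun x => ∑ l ∈ Finset.range (j + 2 + 1), tw (l * s) * ‖commP (phip (s/2)) l F G x‖ₑ) := by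
    apply LN_mono
    intro x
    rw [e]
    refine (enorm_sum_le _ _).trans (le_of_eq ?_)
    apply Finset.sum_congr rfl
    intro l _
    rw [kp_enorm_tw]
  refine (ENNReal.rpow_le_rpow h1 hq.le).trans ?_
  refine (LN_sum_rpow p (b₁ + b₂) q hq hq1 hqp _ (fun l => (commP_meas _ l F G).const_mul _)).trans ?_
  have h2 : ∀ l ∈ Finset.range (j + 2 + 1), LN p (b₁ + b₂) (fun x => tw (l * s) * ‖commP (phip (s/2)) l F G x‖ₑ) ^ q ≤
      ((C * tw (2 * (s - σ) + 4 * δ)) * (tw (j * s + -(δ * ((j:ℝ) - k))) * (LN p₁ b₁ U * LN p₂ b₂ V))) ^ q * tw (-(δ * q * (((j + 2 : ℕ) : ℝ) - l))) := by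
    intro l hl
    rw [Finset.mem_range] at hl
    have e2 : tw (-(δ * q * (((j + 2 : ℕ) : ℝ) - l))) = tw (-(δ * (((j + 2 : ℕ) : ℝ) - l))) ^ q := by
      rw [tw_rpow]; congr 1; ring
    rw [e2, ← ENNReal.mul_rpow_of_nonneg _ _ hq.le]
    apply ENNReal.rpow_le_rpow _ hq.le
    rw [LN_const_mul p hp _ _ (tw_ne_top _)]
    refine (mul_le_mul_right (H l j k hkj (by omega) F G U V hF hG) _).trans ?_
    have e3 := tw_mono (kp_expo hδ1 hδ2 hδ0 j k l hkj (by omega))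
    rw [tw_add, tw_add, tw_add _ (-(δ * ((j + 2 : ℕ) - (l:ℝ))) + (2 * (s - σ) + 4 * δ)), tw_add (-(δ * ((j + 2 : ℕ) - (l:ℝ))))] at e3
    calc _ = C * (LN p₁ b₁ U * LN p₂ b₂ V) * (tw (l * s) * (tw (((j:ℝ) - l) * σ) * tw (-((l - k : ℕ) : ℝ)))) := by ring
      _ ≤ C * (LN p₁ b₁ U * LN p₂ b₂ V) * _ := mul_le_mul_right e3 _
      _ = _ := by ring
  refine (Finset.sum_le_sum h2).trans ?_
  rw [← Finset.mul_sum, ENNReal.mul_rpow_of_nonneg _ _ hq.le]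
  refine (mul_le_mul_right (HD (j + 2)) _).trans (le_of_eq ?_)
  ring

lemma kp_rem2 {n : ℕ} (p p₁ p₂ : ℝ≥0∞) (b₁ b₂ q N s : ℝ) (hq : 0 < q) (hq1 : q ≤ 1)
    (hqp : ENNReal.ofReal q ≤ p) (hp1 : 1 ≤ p₁) (hp2 : 1 ≤ p₂)
    (hexp : 1 / p = 1 / p₁ + 1 / p₂) (hb1 : 0 ≤ b₁) (hb2 : 0 ≤ b₂) (hN : 0 ≤ N) (hs0 : 0 < s)
    (m : ℕ) (hs : s = 2 * m) :
    ∃ δ : ℝ, 0 < δ ∧ δ ≤ s ∧ ∃ C : ℝ≥0∞, C ≠ ⊤ ∧ ∀ j k : ℕ, k ≤ j → ∀ (f g : 𝓢(Eu n, ℂ))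
      (U V : Eu n → ℝ≥0∞), Dom k N (Pl phi k f) U → Dom j N (Pl phi j g) V →
      LN p (b₁ + b₂) (fun x => ‖Jop s (mulS (Pl phi k f) (Pl phi j g)) x - Pl phi k f x * Jop s (Pl phi j g) x‖ₑ) ^ q ≤
        C * (tw (j * s + -(δ * ((j:ℝ) - k))) * (LN p₁ b₁ U * LN p₂ b₂ V)) ^ q := by
  have hq0 : 0 < ENNReal.ofReal q := by simpa using hq
  have hp : p ≠ 0 := (hq0.trans_le hqp).ne'
  have hm : 1 ≤ m := by
    rcases Nat.eq_zero_or_pos m with h | h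
    · subst h; simp at hs; linarith
    · exact h
  have hm' : (1:ℝ) ≤ m := by exact_mod_cast hm
  set σ := (n:ℝ) * (1 / q - 1) with hσ
  have hσ0 : 0 ≤ σ := by
    have : 1 ≤ 1 / q := by rw [le_div_iff₀ hq]; linarith
    have : 0 ≤ 1 / q - 1 := by linarith
    positivity
  obtain ⟨C, hC, H⟩ := kp_comm_Pl (n := n) p p₁ p₂ b₁ b₂ q N hq hq1 hqp hp1 hp2 hexp hb1 hb2 hN (chip_smooth m) (chip_compact m)
  refine ⟨1, one_pos, by linarith, (C * tw (2 * s)) ^ q, (ENNReal.rpow_ne_top_of_nonneg hq.le (ENNReal.mul_ne_top hC (tw_ne_top _))),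
    fun j k hkj f g U V hF hG => ?_⟩
  set F := Pl phi k f
  set G := Pl phi j g with hGd
  have hJ : ∀ H : 𝓢(Eu n, ℂ), Pl chi (j + 2) H = H → ∀ x, Jop s H x = (((2:ℝ) ^ ((j + 2 : ℕ) * s) : ℝ) : ℂ) • Pl (chip m) (j + 2) H x := by
    intro H hH x
    conv_lhs => rw [← hH]
    rw [Jop_Pl s chi_smooth chi_compact (chip_smooth m) (chip_compact m), smul_apply]
    intro r hr
    unfold chip
    rw [hs, mul_div_cancel_left₀ _ (by norm_num), Real.rpow_natCast]
  have e : ∀ x, ‖Jop s (mulS F G) x - F x * Jop s G x‖ₑ = tw ((j + 2 : ℕ) * s) * ‖commP (chip m) (j + 2) F G x‖ₑ := by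
    intro x
    rw [hJ _ (Pl_chi_FG hkj f g), hJ _ (Pl_chi_G j g), ← kp_enorm_tw]
    congr 1
    unfold commP
    simp only [smul_eq_mul]; ring
  simp_rw [e]
  rw [LN_const_mul p hp _ _ (tw_ne_top _), ← ENNReal.mul_rpow_of_nonneg _ _ hq.le]
  apply ENNReal.rpow_le_rpow _ hq.le
  refine (mul_le_mul_right (H (j + 2) j k hkj le_rfl F G U V hF hG) _).trans ?_
  have e3 : tw ((j + 2 : ℕ) * s) * (tw (((j:ℝ) - (j + 2 : ℕ)) * σ) * tw (-((j + 2 - k : ℕ) : ℝ))) ≤ tw (2 * s) * tw (j * s + -(1 * ((j:ℝ) - k))) := by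
    rw [← tw_add, ← tw_add, ← tw_add]
    apply tw_mono
    rw [Nat.cast_sub (by omega)]
    push_cast
    nlinarith
  calc _ = C * (LN p₁ b₁ U * LN p₂ b₂ V) * (tw ((j + 2 : ℕ) * s) * (tw (((j:ℝ) - (j + 2 : ℕ)) * σ) * tw (-((j + 2 - k : ℕ) : ℝ)))) := by ring
    _ ≤ C * (LN p₁ b₁ U * LN p₂ b₂ V) * _ := mul_le_mul_right e3 _
    _ = _ := by ring

end

section
open FourierTransform
open scoped SchwartzMap ContDiff

def Rem {n : ℕ} (s : ℝ) (f g : 𝓢(Eu n, ℂ)) (k j : ℕ) (x : Eu n) : ℂ :=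
  Jop s (mulS (Pl phi k f) (Pl phi j g)) x - Pl phi k f x * Jop s (Pl phi j g) x - Pl phi j g x * Jop s (Pl phi k f) x

lemma mulS_comm {n : ℕ} (f g : 𝓢(Eu n, ℂ)) : mulS f g = mulS g f := by
  ext x; rw [mulS_apply, mulS_apply, mul_comm]

lemma Rem_symm {n : ℕ} (s : ℝ) (f g : 𝓢(Eu n, ℂ)) (k j : ℕ) (x : Eu n) : Rem s f g k j x = Rem s g f j k x := by
  unfold Rem
  rw [mulS_comm]; ring

lemma Rem_meas {n : ℕ} (s : ℝ) (f g : 𝓢(Eu n, ℂ)) (k j : ℕ) : Measurable (fun x => ‖Rem s f g k j x‖ₑ) := by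
  unfold Rem
  exact (((S_meas _).sub ((S_meas _).mul (S_meas _))).sub ((S_meas _).mul (S_meas _))).enorm

lemma kp_min_rpow (a b : ℝ≥0∞) {q : ℝ} (hq : 0 ≤ q) : (min a b) ^ q = min (a ^ q) (b ^ q) :=
  (ENNReal.monotone_rpow_of_nonneg hq).map_min

lemma kp_Rsum {n : ℕ} (p p₁ p₂ : ℝ≥0∞) (b₁ b₂ q s : ℝ) (hq : 0 < q) (hq1 : q ≤ 1)
    (hqp : ENNReal.ofReal q ≤ p) (hp1 : 1 ≤ p₁) (hp2 : 1 ≤ p₂)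
    (hexp : 1 / p = 1 / p₁ + 1 / p₂) (hb1 : 0 ≤ b₁) (hb2 : 0 ≤ b₂) (hs0 : 0 < s)
    (hs : n * (1 / q - 1) < s ∨ ∃ m : ℕ, s = 2 * m) :
    ∃ C : ℝ≥0∞, C ≠ ⊤ ∧ ∀ (f g : 𝓢(Eu n, ℂ)) (L : ℕ),
      ∑ j ∈ Finset.range L, ∑ k ∈ Finset.range (j + 1), LN p (b₁ + b₂) (fun x => ‖Rem s f g k j x‖ₑ) ^ q ≤
        C * (sn p₁ b₁ (Jop s f) ^ q * sn p₂ b₂ g ^ q + sn p₁ b₁ f ^ q * sn p₂ b₂ (Jop s g) ^ q) := by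
  have hq0 : 0 < ENNReal.ofReal q := by simpa using hq
  have hp : p ≠ 0 := (hq0.trans_le hqp).ne'
  have hp1' : p₁ ≠ 0 := (zero_lt_one.trans_le hp1).ne'
  have hp2' : p₂ ≠ 0 := (zero_lt_one.trans_le hp2).ne'
  obtain ⟨N, hN⟩ := exists_nat_gt ((n:ℝ) + b₁ + b₂)
  have hrem : ∃ δ : ℝ, 0 < δ ∧ δ ≤ s ∧ ∃ C : ℝ≥0∞, C ≠ ⊤ ∧ ∀ j k : ℕ, k ≤ j → ∀ (f g : 𝓢(Eu n, ℂ))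
      (U V : Eu n → ℝ≥0∞), Dom k N (Pl phi k f) U → Dom j N (Pl phi j g) V →
      LN p (b₁ + b₂) (fun x => ‖Jop s (mulS (Pl phi k f) (Pl phi j g)) x - Pl phi k f x * Jop s (Pl phi j g) x‖ₑ) ^ q ≤
        C * (tw (j * s + -(δ * ((j:ℝ) - k))) * (LN p₁ b₁ U * LN p₂ b₂ V)) ^ q := by
    rcases hs with hs | ⟨m, hs⟩
    · exact kp_rem1 p p₁ p₂ b₁ b₂ q N s hq hq1 hqp hp1 hp2 hexp hb1 hb2 (Nat.cast_nonneg N) hs0 hs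
    · exact kp_rem2 p p₁ p₂ b₁ b₂ q N s hq hq1 hqp hp1 hp2 hexp hb1 hb2 (Nat.cast_nonneg N) hs0 m hs
  obtain ⟨δ, hδ, hδs, C0, hC0, H0⟩ := hrem
  obtain ⟨C1, hC1, H1⟩ := kp_piece (n := n) p₁ hp1 b₁ hb1 s N (by linarith)
  obtain ⟨C2, hC2, H2⟩ := kp_piece (n := n) p₂ hp2 b₂ hb2 s N (by linarith)
  obtain ⟨C3, hC3, H3⟩ := kp_sum_enn ((2:ℝ) ^ (s * q)) ((2:ℝ) ^ (-(δ * q))) (Real.one_lt_rpow (by norm_num) (by positivity))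
    (by positivity) (Real.rpow_lt_one_of_one_lt_of_neg (by norm_num) (by have := mul_pos hδ hq; linarith))
  set K := (C0 + 1) * (C1 * C2) ^ q with hK
  have hKt : K ≠ ⊤ := ENNReal.mul_ne_top (by simp [hC0]) (ENNReal.rpow_ne_top_of_nonneg hq.le (ENNReal.mul_ne_top hC1 hC2))
  refine ⟨K * ENNReal.ofReal C3, ENNReal.mul_ne_top hKt ENNReal.ofReal_ne_top, fun f g L => ?_⟩
  have key : ∀ j k : ℕ, k ≤ j → LN p (b₁ + b₂) (fun x => ‖Rem s f g k j x‖ₑ) ^ q ≤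
      K * (ENNReal.ofReal (((2:ℝ) ^ (s * q)) ^ j * ((2:ℝ) ^ (-(δ * q))) ^ (j - k)) *
        (min (sn p₁ b₁ f ^ q) (ENNReal.ofReal (((2:ℝ) ^ (s * q)) ^ k)⁻¹ * sn p₁ b₁ (Jop s f) ^ q) *
         min (sn p₂ b₂ g ^ q) (ENNReal.ofReal (((2:ℝ) ^ (s * q)) ^ j)⁻¹ * sn p₂ b₂ (Jop s g) ^ q))) := by
    intro j k hkj
    obtain ⟨U, hU, hU1, hU2⟩ := H1 k f
    obtain ⟨V, hV, hV1, hV2⟩ := H2 j g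
    have hkj' : (k:ℝ) ≤ j := by exact_mod_cast hkj
    set E := tw (j * s + -(δ * ((j:ℝ) - k))) with hE
    have s1 := H0 j k hkj f g U V hU hV
    have s2 : LN p (b₁ + b₂) (fun x => ‖Pl phi j g x * Jop s (Pl phi k f) x‖ₑ) ^ q ≤ (E * (LN p₁ b₁ U * LN p₂ b₂ V)) ^ q := by
      apply ENNReal.rpow_le_rpow _ hq.le
      have : LN p (b₁ + b₂) (fun x => ‖Pl phi j g x * Jop s (Pl phi k f) x‖ₑ) ≤ LN p (b₁ + b₂) (fun x => tw (k * s) * (U x * V x)) := by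
        apply LN_mono
        intro x
        rw [enorm_mul]
        calc _ ≤ V x * (tw (k * s) * U x) := mul_le_mul' (hV.bd x) (hU1 x)
          _ = _ := by ring
      refine this.trans ?_
      rw [LN_const_mul p hp _ _ (tw_ne_top _)]
      refine mul_le_mul' (tw_mono ?_) (LN_holder p p₁ p₂ b₁ b₂ hp hp1' hp2' hexp hU.meas hV.meas)
      nlinarith
    have s3 : LN p (b₁ + b₂) (fun x => ‖Rem s f g k j x‖ₑ) ^ q ≤ (C0 + 1) * (E * (LN p₁ b₁ U * LN p₂ b₂ V)) ^ q := by
      have m1 : Measurable (fun x => ‖Jop s (mulS (Pl phi k f) (Pl phi j g)) x - Pl phi k f x * Jop s (Pl phi j g) x‖ₑ) :=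
        ((S_meas _).sub ((S_meas _).mul (S_meas _))).enorm
      have m2 : Measurable (fun x => ‖Pl phi j g x * Jop s (Pl phi k f) x‖ₑ) := ((S_meas _).mul (S_meas _)).enorm
      refine (ENNReal.rpow_le_rpow (LN_mono p _ fun x => enorm_sub_le) hq.le).trans ?_
      refine (LN_add_rpow p _ q hq hq1 hqp m1 m2).trans ?_
      rw [add_mul, one_mul]
      exact add_le_add s1 s2
    refine s3.trans ?_
    rw [hK, mul_assoc]
    gcongr
    have e1 : ENNReal.ofReal (((2:ℝ) ^ (s * q)) ^ j * ((2:ℝ) ^ (-(δ * q))) ^ (j - k)) = E ^ q := by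
      rw [hE, tw_rpow, tw_ofReal, ← Real.rpow_natCast, ← Real.rpow_natCast, ← Real.rpow_mul (by norm_num), ← Real.rpow_mul (by norm_num),
        ← Real.rpow_add (by norm_num), Nat.cast_sub hkj]
      congr 2; ring
    have e2 : ∀ i : ℕ, ENNReal.ofReal (((2:ℝ) ^ (s * q)) ^ i)⁻¹ = tw (-(i * s)) ^ q := by
      intro i
      rw [tw_rpow, tw_ofReal, ← Real.rpow_natCast, ← Real.rpow_mul (by norm_num), ← Real.rpow_neg (by norm_num)]
      congr 2; ring
    rw [e1, e2, e2]
    simp only [← ENNReal.mul_rpow_of_nonneg _ _ hq.le, ← kp_min_rpow _ _ hq.le]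
    apply ENNReal.rpow_le_rpow _ hq.le
    calc _ ≤ E * ((C1 * min (sn p₁ b₁ f) (tw (-(k * s)) * sn p₁ b₁ (Jop s f))) * (C2 * min (sn p₂ b₂ g) (tw (-(j * s)) * sn p₂ b₂ (Jop s g)))) := by gcongr
      _ = _ := by ring
  calc _ ≤ ∑ j ∈ Finset.range L, ∑ k ∈ Finset.range (j + 1), K * (ENNReal.ofReal (((2:ℝ) ^ (s * q)) ^ j * ((2:ℝ) ^ (-(δ * q))) ^ (j - k)) *
        (min (sn p₁ b₁ f ^ q) (ENNReal.ofReal (((2:ℝ) ^ (s * q)) ^ k)⁻¹ * sn p₁ b₁ (Jop s f) ^ q) *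
         min (sn p₂ b₂ g ^ q) (ENNReal.ofReal (((2:ℝ) ^ (s * q)) ^ j)⁻¹ * sn p₂ b₂ (Jop s g) ^ q))) := by
        apply Finset.sum_le_sum
        intro j _
        apply Finset.sum_le_sum
        intro k hk
        rw [Finset.mem_range] at hk
        exact key j k (by omega)
    _ = K * ∑ j ∈ Finset.range L, ∑ k ∈ Finset.range (j + 1), (ENNReal.ofReal (((2:ℝ) ^ (s * q)) ^ j * ((2:ℝ) ^ (-(δ * q))) ^ (j - k)) *
        (min (sn p₁ b₁ f ^ q) (ENNReal.ofReal (((2:ℝ) ^ (s * q)) ^ k)⁻¹ * sn p₁ b₁ (Jop s f) ^ q) *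
         min (sn p₂ b₂ g ^ q) (ENNReal.ofReal (((2:ℝ) ^ (s * q)) ^ j)⁻¹ * sn p₂ b₂ (Jop s g) ^ q))) := by
        simp_rw [Finset.mul_sum]
    _ ≤ _ := by
        rw [mul_assoc K]
        exact mul_le_mul_right (H3 _ _ _ _ L) _

lemma kp_square (a : ℕ → ℕ → ℝ≥0∞) (L : ℕ) : ∑ k ∈ Finset.range L, ∑ j ∈ Finset.range L, a k j ≤
    ∑ j ∈ Finset.range L, ∑ k ∈ Finset.range (j + 1), (a k j + a j k) := by
  induction L with
  | zero => simp
  | succ L ih =>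
    rw [Finset.sum_range_succ, Finset.sum_range_succ (n := L) (f := fun j => ∑ k ∈ Finset.range (j + 1), (a k j + a j k))]
    simp_rw [Finset.sum_add_distrib]
    have : ∑ k ∈ Finset.range L, ∑ j ∈ Finset.range (L + 1), a k j = ∑ k ∈ Finset.range L, ∑ j ∈ Finset.range L, a k j + ∑ k ∈ Finset.range L, a k L := by
      rw [← Finset.sum_add_distrib]
      apply Finset.sum_congr rfl
      intro k _
      rw [Finset.sum_range_succ]
    rw [this]
    simp_rw [Finset.sum_add_distrib] at ih
    calc _ = ∑ k ∈ Finset.range L, ∑ j ∈ Finset.range L, a k j + (∑ k ∈ Finset.range L, a k L + ∑ j ∈ Finset.range (L + 1), a L j) := by ring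
      _ ≤ _ := by
        gcongr
        · simpa [Finset.sum_add_distrib] using ih

end

section
open FourierTransform
open scoped SchwartzMap ContDiff

lemma kp_ident {n : ℕ} (s : ℝ) (f g : 𝓢(Eu n, ℂ)) (N : ℕ) (x : Eu n) :
    Jop s (mulS (Pl chi N f) (Pl chi N g)) x =
      Pl chi N f x * Jop s (Pl chi N g) x + Jop s (Pl chi N f) x * Pl chi N g x +
        ∑ k ∈ Finset.range (N + 1), ∑ j ∈ Finset.range (N + 1), Rem s f g k j x := by
  have e : mulS (Pl chi N f) (Pl chi N g) = ∑ k ∈ Finset.range (N + 1), ∑ j ∈ Finset.range (N + 1), mulS (Pl phi k f) (Pl phi j g) := by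
    ext y
    rw [mulS_apply, Pl_chi_sum, Pl_chi_sum, SchwartzMap.sum_apply, SchwartzMap.sum_apply, SchwartzMap.sum_apply, Finset.sum_mul_sum]
    simp only [SchwartzMap.sum_apply, mulS_apply]
  rw [e, Pl_chi_sum, Pl_chi_sum]
  simp only [map_sum, SchwartzMap.sum_apply, Finset.sum_mul_sum]
  simp only [Rem, ← Finset.sum_add_distrib]
  refine Finset.sum_congr rfl fun k _ => Finset.sum_congr rfl fun j _ => ?_
  ring

lemma kp_Npiece {n : ℕ} (s : ℝ) (f g : 𝓢(Eu n, ℂ)) (N : ℕ) (x : Eu n) :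
    ‖Jop s (mulS (Pl chi N f) (Pl chi N g)) x‖ₑ ≤
      (‖Pl chi N f x‖ₑ * ‖Jop s (Pl chi N g) x‖ₑ + ‖Jop s (Pl chi N f) x‖ₑ * ‖Pl chi N g x‖ₑ) +
        ∑ j ∈ Finset.range (N + 1), ∑ k ∈ Finset.range (j + 1), (‖Rem s f g k j x‖ₑ + ‖Rem s g f k j x‖ₑ) := by
  rw [kp_ident, ← enorm_mul, ← enorm_mul]
  refine (enorm_add_le _ _).trans (add_le_add (enorm_add_le _ _) ?_)
  refine (enorm_sum_le _ _).trans ?_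
  refine (Finset.sum_le_sum fun k _ => enorm_sum_le _ _).trans ?_
  refine (kp_square _ _).trans (le_of_eq ?_)
  refine Finset.sum_congr rfl fun j _ => Finset.sum_congr rfl fun k _ => ?_
  rw [Rem_symm s f g j k]

lemma kp_lsym_lim {n : ℕ} (η : Eu n) : Filter.Tendsto (fun N => lsym chi N η) Filter.atTop (nhds 1) := by
  apply tendsto_const_nhds.congr'
  have := (tendsto_pow_atTop_atTop_of_one_lt (r := (4:ℝ)) (by norm_num)).eventually_ge_atTop (br η)
  filter_upwards [this] with N hN
  unfold lsym
  rw [chi_one, Complex.ofReal_one]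
  rw [abs_of_pos (mul_pos (kp_four N) (br_pos η)), inv_mul_le_iff₀ (by positivity), mul_one]
  exact hN

lemma kp_core {n : ℕ} (p p₁ p₂ : ℝ≥0∞) (b₁ b₂ q s : ℝ) (hq : 0 < q) (hq1 : q ≤ 1)
    (hqp : ENNReal.ofReal q ≤ p) (hp1 : 1 ≤ p₁) (hp2 : 1 ≤ p₂)
    (hexp : 1 / p = 1 / p₁ + 1 / p₂) (hb1 : 0 ≤ b₁) (hb2 : 0 ≤ b₂) (hs0 : 0 < s)
    (hs : n * (1 / q - 1) < s ∨ ∃ m : ℕ, s = 2 * m) :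
    ∃ C : ℝ≥0∞, C ≠ ⊤ ∧ ∀ (f g : 𝓢(Eu n, ℂ)),
      LN p (b₁ + b₂) (fun x => ‖Jop s (mulS f g) x‖ₑ) ≤
        C * (sn p₁ b₁ (Jop s f) * sn p₂ b₂ g + sn p₁ b₁ f * sn p₂ b₂ (Jop s g)) := by
  have hq0 : 0 < ENNReal.ofReal q := by simpa using hq
  have hp : p ≠ 0 := (hq0.trans_le hqp).ne'
  have hp1' : p₁ ≠ 0 := (zero_lt_one.trans_le hp1).ne'
  have hp2' : p₂ ≠ 0 := (zero_lt_one.trans_le hp2).ne'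
  obtain ⟨C1, hC1, H1⟩ := Pl_LN (n := n) p₁ hp1 b₁ hb1 chi_smooth chi_compact
  obtain ⟨C2, hC2, H2⟩ := Pl_LN (n := n) p₂ hp2 b₂ hb2 chi_smooth chi_compact
  obtain ⟨C3, hC3, H3⟩ := kp_Rsum (n := n) p p₁ p₂ b₁ b₂ q s hq hq1 hqp hp1 hp2 hexp hb1 hb2 hs0 hs
  obtain ⟨C4, hC4, H4⟩ := kp_Rsum (n := n) p p₂ p₁ b₂ b₁ q s hq hq1 hqp hp2 hp1 (by rw [hexp, add_comm]) hb2 hb1 hs0 hs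
  set D := (C1 * C2) ^ q with hD
  have hDt : D ≠ ⊤ := ENNReal.rpow_ne_top_of_nonneg hq.le (ENNReal.mul_ne_top hC1 hC2)
  set K := (D + D) + (C3 * 2 + C4 * 2) with hK
  have hKt : K ≠ ⊤ := by
    rw [hK]; finiteness
  refine ⟨K ^ (1 / q), ENNReal.rpow_ne_top_of_nonneg (by positivity) hKt, fun f g => ?_⟩
  set Z := sn p₁ b₁ (Jop s f) * sn p₂ b₂ g + sn p₁ b₁ f * sn p₂ b₂ (Jop s g) with hZ
  have hZ1 : sn p₁ b₁ (Jop s f) ^ q * sn p₂ b₂ g ^ q ≤ Z ^ q := by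
    rw [← ENNReal.mul_rpow_of_nonneg _ _ hq.le]
    exact ENNReal.rpow_le_rpow (by rw [hZ]; exact le_self_add) hq.le
  have hZ2 : sn p₁ b₁ f ^ q * sn p₂ b₂ (Jop s g) ^ q ≤ Z ^ q := by
    rw [← ENNReal.mul_rpow_of_nonneg _ _ hq.le]
    exact ENNReal.rpow_le_rpow (by rw [hZ]; exact le_add_self) hq.le
  have main : ∀ N : ℕ, LN p (b₁ + b₂) (fun x => ‖Jop s (mulS (Pl chi N f) (Pl chi N g)) x‖ₑ) ≤ K ^ (1 / q) * Z := by
    intro N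
    apply kp_of_rpow_le hq
    refine (ENNReal.rpow_le_rpow (LN_mono p _ (kp_Npiece s f g N)) hq.le).trans ?_
    have m1 : Measurable (fun x => ‖Pl chi N f x‖ₑ * ‖Jop s (Pl chi N g) x‖ₑ) := (S_emeas _).mul (S_emeas _)
    have m2 : Measurable (fun x => ‖Jop s (Pl chi N f) x‖ₑ * ‖Pl chi N g x‖ₑ) := (S_emeas _).mul (S_emeas _)
    have m3 : ∀ j k, Measurable (fun x => ‖Rem s f g k j x‖ₑ + ‖Rem s g f k j x‖ₑ) := fun j k => (Rem_meas _ _ _ _ _).add (Rem_meas _ _ _ _ _)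
    have m4 : ∀ j, Measurable (fun x => ∑ k ∈ Finset.range (j + 1), (‖Rem s f g k j x‖ₑ + ‖Rem s g f k j x‖ₑ)) :=
      fun j => Finset.measurable_fun_sum _ fun k _ => m3 j k
    refine (LN_add_rpow p _ q hq hq1 hqp (m1.add m2) (Finset.measurable_fun_sum _ fun j _ => m4 j)).trans ?_
    rw [hK, add_mul]
    refine add_le_add ?_ ?_
    · refine (LN_add_rpow p _ q hq hq1 hqp m1 m2).trans ?_
      rw [add_mul]
      refine add_le_add ?_ ?_
      · rw [hD, ← ENNReal.mul_rpow_of_nonneg _ _ hq.le]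
        refine ENNReal.rpow_le_rpow ?_ hq.le
        refine (LN_holder p p₁ p₂ b₁ b₂ hp hp1' hp2' hexp (S_emeas _) (S_emeas _)).trans ?_
        rw [Pl_comm s chi_smooth chi_compact]
        refine (mul_le_mul' (H1 N f) (H2 N (Jop s g))).trans ?_
        calc _ = (C1 * C2) * (sn p₁ b₁ f * sn p₂ b₂ (Jop s g)) := by ring
          _ ≤ _ := by rw [hZ]; gcongr; exact le_add_self
      · rw [hD, ← ENNReal.mul_rpow_of_nonneg _ _ hq.le]
        refine ENNReal.rpow_le_rpow ?_ hq.le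
        refine (LN_holder p p₁ p₂ b₁ b₂ hp hp1' hp2' hexp (S_emeas _) (S_emeas _)).trans ?_
        rw [Pl_comm s chi_smooth chi_compact]
        refine (mul_le_mul' (H1 N (Jop s f)) (H2 N g)).trans ?_
        calc _ = (C1 * C2) * (sn p₁ b₁ (Jop s f) * sn p₂ b₂ g) := by ring
          _ ≤ _ := by rw [hZ]; gcongr; exact le_self_add
    · refine (LN_sum_rpow p _ q hq hq1 hqp _ m4).trans ?_
      have h3 := H3 f g (N + 1)
      have h4 := H4 g f (N + 1)
      rw [add_comm b₂ b₁] at h4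
      calc _ ≤ ∑ j ∈ Finset.range (N + 1), ∑ k ∈ Finset.range (j + 1),
              (LN p (b₁ + b₂) (fun x => ‖Rem s f g k j x‖ₑ) ^ q + LN p (b₁ + b₂) (fun x => ‖Rem s g f k j x‖ₑ) ^ q) := by
            refine Finset.sum_le_sum fun j _ => ?_
            refine (LN_sum_rpow p _ q hq hq1 hqp _ (m3 j)).trans ?_
            refine Finset.sum_le_sum fun k _ => ?_
            exact LN_add_rpow p _ q hq hq1 hqp (Rem_meas _ _ _ _ _) (Rem_meas _ _ _ _ _)
        _ = _ := by simp_rw [Finset.sum_add_distrib]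
        _ ≤ _ := add_le_add h3 h4
        _ ≤ C3 * (Z ^ q + Z ^ q) + C4 * (Z ^ q + Z ^ q) := by
            refine add_le_add (mul_le_mul_right (add_le_add hZ1 hZ2) _) (mul_le_mul_right ?_ _)
            refine add_le_add ?_ ?_
            · rw [mul_comm]; exact hZ2
            · rw [mul_comm]; exact hZ1
        _ = _ := by ring
  refine LN_fatou p _ (fun N => S_emeas _) (fun x => ?_) _ main
  refine Filter.Tendsto.enorm ?_
  refine Jop_prod_tendsto hs0.le (fun N => lsym chi N) (fun N => lsym_tg chi_smooth chi_compact N) ?_ kp_lsym_lim f g x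
  intro N η
  unfold lsym
  rw [Complex.norm_real, Real.norm_of_nonneg (chi_nonneg _)]
  exact chi_le _

lemma Jop_zero {n : ℕ} (f : 𝓢(Eu n, ℂ)) : Jop 0 f = f := by
  apply ft_ext
  intro η
  rw [ft_Jop]
  simp [msym]

end

/-- **The Kato–Ponce inequality with polynomial weights** (Theorem 1.1, positive direction). -/
theorem weighted_kato_ponce (n : ℕ) (hn : 1 ≤ n) (p p₁ p₂ : ℝ≥0∞) (a a₁ a₂ s : ℝ)
    (hp : 2⁻¹ ≤ p) (hp1 : 1 ≤ p₁) (hp2 : 1 ≤ p₂)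
    (ha : 0 ≤ a) (ha1 : 0 ≤ a₁) (ha2 : 0 ≤ a₂)
    (hexp : 1 / p = 1 / p₁ + 1 / p₂)
    (hwexp : ENNReal.ofReal a / p = ENNReal.ofReal a₁ / p₁ + ENNReal.ofReal a₂ / p₂)
    (hs : max 0 ((n : ℝ) * (1 / p.toReal - 1)) < s ∨ ∃ m : ℕ, s = 2 * m) :
    ∃ C : ℝ, 0 < C ∧ ∀ f g : SchwartzMap (Eu n) ℂ,
      wNorm p a (Js s (fun x => f x * g x)) ≤
        ENNReal.ofReal C *
          (wNorm p₁ a₁ (Js s ⇑f) * wNorm p₂ a₂ ⇑g +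
            wNorm p₁ a₁ ⇑f * wNorm p₂ a₂ (Js s ⇑g)) := by
  have hp0 : p ≠ 0 := by
    rintro rfl
    simp at hp
  have hp1' : p₁ ≠ 0 := (zero_lt_one.trans_le hp1).ne'
  have hp2' : p₂ ≠ 0 := (zero_lt_one.trans_le hp2).ne'
  have hb : a / p.toReal = a₁ / p₁.toReal + a₂ / p₂.toReal := by
    have h := congrArg ENNReal.toReal hwexp
    rw [ENNReal.toReal_add (ENNReal.div_ne_top ENNReal.ofReal_ne_top hp1') (ENNReal.div_ne_top ENNReal.ofReal_ne_top hp2'),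
      ENNReal.toReal_div, ENNReal.toReal_div, ENNReal.toReal_div, ENNReal.toReal_ofReal ha, ENNReal.toReal_ofReal ha1, ENNReal.toReal_ofReal ha2] at h
    exact h
  have hb1 : 0 ≤ a₁ / p₁.toReal := by positivity
  have hb2 : 0 ≤ a₂ / p₂.toReal := by positivity
  have hJ : ∀ f : SchwartzMap (Eu n) ℂ, Js s ⇑f = ⇑(Jop s f) := fun f => funext fun x => Js_eq s f x
  have hm : ∀ f g : SchwartzMap (Eu n) ℂ, (fun x => f x * g x) = ⇑(mulS f g) := fun f g => rfl
  suffices H : ∃ C : ℝ≥0∞, C ≠ ⊤ ∧ ∀ (f g : SchwartzMap (Eu n) ℂ),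
      LN p (a₁ / p₁.toReal + a₂ / p₂.toReal) (fun x => ‖Jop s (mulS f g) x‖ₑ) ≤
        C * (sn p₁ (a₁ / p₁.toReal) (Jop s f) * sn p₂ (a₂ / p₂.toReal) g + sn p₁ (a₁ / p₁.toReal) f * sn p₂ (a₂ / p₂.toReal) (Jop s g)) by
    obtain ⟨C, hC, H⟩ := H
    refine ⟨C.toReal + 1, by positivity, fun f g => ?_⟩
    rw [hm, hJ, hJ, hJ, wNorm_eq_LN p hp0, wNorm_eq_LN p₁ hp1', wNorm_eq_LN p₁ hp1', wNorm_eq_LN p₂ hp2', wNorm_eq_LN p₂ hp2', hb]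
    refine (H f g).trans ?_
    refine mul_le_mul_left ?_ _
    rw [← ENNReal.ofReal_toReal hC]
    apply ENNReal.ofReal_le_ofReal
    rw [ENNReal.toReal_ofReal ENNReal.toReal_nonneg]
    linarith
  by_cases hs0 : s = 0
  · subst hs0
    refine ⟨1, by simp, fun f g => ?_⟩
    rw [Jop_zero, Jop_zero, Jop_zero, one_mul]
    refine le_trans ?_ le_self_add
    refine le_trans (LN_mono _ _ fun x => ?_) (LN_holder p p₁ p₂ _ _ hp0 hp1' hp2' hexp (S_emeas f) (S_emeas g))
    rw [mulS_apply, enorm_mul]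
  · have hsp : 0 < s := by
      rcases hs with h | ⟨m, h⟩
      · exact (le_max_left _ _).trans_lt h
      · have : 0 ≤ s := by rw [h]; positivity
        exact lt_of_le_of_ne this (Ne.symm hs0)
    by_cases hp1s : 1 ≤ p
    · refine kp_core p p₁ p₂ _ _ 1 s one_pos le_rfl (by simpa using hp1s) hp1 hp2 hexp hb1 hb2 hsp (Or.inl ?_)
      simpa using hsp
    · push Not at hp1s
      have hpt : p ≠ ⊤ := hp1s.ne_top
      refine kp_core p p₁ p₂ _ _ p.toReal s (ENNReal.toReal_pos hp0 hpt) ?_ (by rw [ENNReal.ofReal_toReal hpt]) hp1 hp2 hexp hb1 hb2 hsp ?_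
      · exact (ENNReal.toReal_le_of_le_ofReal zero_le_one (by simpa using hp1s.le))
      · rcases hs with h | h
        · exact Or.inl ((le_max_right _ _).trans_lt h)
        · exact Or.inr h
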